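/- arXiv:0707.2136 — 6 statements merged into one kernel-verified Lean document; each statement's English description precedes it below -/
import Mathlib

section
/- Let (x_1,…,x_r) be part of a reducing system of parameters of M. If r < d = dim_R M, then for any permutation π of {1,…,r}, the sequence (x_{π(1)},…,x_{π(r)}) is part of a reducing system of parameters of M. -/
open IsLocalRing

/-- Krull dimension of a module: `dim_R M := dim (R ⧸ Ann_R M)`. -/
noncomputable def moduleDim (R M : Type*) [CommRing R] [AddCommGroup M] [Module R M] :
    WithBot (WithTop ℕ) :=
  ringKrullDim (R ⧸ Module.annihilator R M)

/-- Depth of a module over a local ring: supremum of lengths of regular sequences on `M`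
consisting of elements of the maximal ideal. -/
noncomputable def moduleDepth (R M : Type*) [CommRing R] [IsLocalRing R] [AddCommGroup M]
    [Module R M] : WithBot (WithTop ℕ) :=
  sSup {n : WithBot (WithTop ℕ) | ∃ rs : List R, (rs.length : WithBot (WithTop ℕ)) = n ∧
    (∀ x ∈ rs, x ∈ maximalIdeal R) ∧ RingTheory.Sequence.IsRegular M rs}

/-- `M` is a Cohen–Macaulay module over the local ring `R` iff `depth_R M = dim_R M`. -/
def IsCMModule (R M : Type*) [CommRing R] [IsLocalRing R] [AddCommGroup M] [Module R M] : Prop :=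
  moduleDepth R M = moduleDim R M

/-- `(x 0, …, x (d-1))` is a system of parameters of `M`: the `x i` lie in the maximal ideal,
`d = dim_R M`, and `M ⧸ (x 0, …, x (d-1))M` has finite length. -/
def IsSoP (R M : Type*) [CommRing R] [IsLocalRing R] [AddCommGroup M] [Module R M]
    {d : ℕ} (x : Fin d → R) : Prop :=
  (∀ i, x i ∈ maximalIdeal R) ∧ moduleDim R M = (d : ℕ) ∧
    IsFiniteLength R (M ⧸ (Ideal.span (Set.range x) • (⊤ : Submodule R M)))

/-- A system of parameters `(x 0, …, x (d-1))` of `M` is reducing if for `i = 1, …, d-1`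
(i.e. 0-based indices `i` with `i < d - 1`) the element `x i` avoids all associated primes `P`
of `M ⧸ (x 0, …, x (i-1))M` with `dim R/P = d - (i + 1)`. -/
def IsReducingSoP (R M : Type*) [CommRing R] [IsLocalRing R] [AddCommGroup M] [Module R M]
    {d : ℕ} (x : Fin d → R) : Prop :=
  IsSoP R M x ∧ ∀ i : Fin d, (i : ℕ) < d - 1 →
    ∀ P ∈ associatedPrimes R
      (M ⧸ (Ideal.span (x '' {j : Fin d | (j : ℕ) < (i : ℕ)}) • (⊤ : Submodule R M))),
      ringKrullDim (R ⧸ P) = ((d - ((i : ℕ) + 1) : ℕ) : WithBot (WithTop ℕ)) → x i ∉ P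

/-- `(x 0, …, x (r-1))` is part of a system of parameters of `M`,
i.e. it extends to a system of parameters of `M`. -/
def IsPartSoP (R M : Type*) [CommRing R] [IsLocalRing R] [AddCommGroup M] [Module R M]
    {r : ℕ} (x : Fin r → R) : Prop :=
  ∃ (d : ℕ) (hrd : r ≤ d) (y : Fin d → R), IsSoP R M y ∧ ∀ i : Fin r, y (Fin.castLE hrd i) = x i

/-- `(x 0, …, x (r-1))` is part of a reducing system of parameters of `M`,
i.e. it extends to a reducing system of parameters of `M`. -/
def IsPartReducingSoP (R M : Type*) [CommRing R] [IsLocalRing R] [AddCommGroup M] [Module R M]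
    {r : ℕ} (x : Fin r → R) : Prop :=
  ∃ (d : ℕ) (hrd : r ≤ d) (y : Fin d → R),
    IsReducingSoP R M y ∧ ∀ i : Fin r, y (Fin.castLE hrd i) = x i

theorem mem_span_singleton_smul_top {R N : Type*} [CommRing R] [AddCommGroup N] [Module R N]
    {x : R} {m : N} : m ∈ Ideal.span {x} • (⊤ : Submodule R N) ↔ ∃ n, x • n = m := by
  rw [Submodule.ideal_span_singleton_smul, Submodule.mem_smul_pointwise_iff_exists]
  simp

/-- Quotienting successively by `I` and by `x` has the same associated primes as quotienting by
`I + (x)`. -/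
theorem associatedPrimes_quotient_sup_span_singleton {R N : Type*} [CommRing R]
    [AddCommGroup N] [Module R N] (I : Ideal R) (x : R) :
    associatedPrimes R (N ⧸ ((I ⊔ Ideal.span {x}) • (⊤ : Submodule R N))) =
      associatedPrimes R ((N ⧸ (I • (⊤ : Submodule R N))) ⧸
        (Ideal.span {x} • (⊤ : Submodule R (N ⧸ (I • (⊤ : Submodule R N)))))) := by
  have hmap : (Ideal.span {x} • (⊤ : Submodule R N)).map (I • (⊤ : Submodule R N)).mkQ =
      Ideal.span {x} • ⊤ := by
    rw [Submodule.map_smul'', Submodule.map_top, Submodule.range_mkQ]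
  exact (LinearEquiv.AssociatedPrimes.eq
    ((Submodule.quotEquivOfEq _ _ hmap).symm ≪≫ₗ
      Submodule.quotientQuotientEquivQuotientSup (I • (⊤ : Submodule R N)) (Ideal.span {x} • ⊤) ≪≫ₗ
      Submodule.quotEquivOfEq _ _ (Submodule.sup_smul _ _ _).symm)).symm

theorem isMaximal_of_annihilator_le_of_isArtinian {R M : Type*} [CommRing R]
    [IsNoetherianRing R] [AddCommGroup M] [Module R M] [Module.Finite R M] [IsArtinian R M]
    {Q : Ideal R} (hQ : Q.IsPrime) (h : Module.annihilator R M ≤ Q) : Q.IsMaximal := by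
  obtain ⟨P, hP, hPQ⟩ := Ideal.exists_minimalPrimes_le h
  obtain ⟨hPp, f, hf⟩ := (isAssociatedPrime_iff_exists_injective_linearMap _ _).mp
      (Module.associatedPrimes.minimalPrimes_annihilator_subset_associatedPrimes R M hP)
  have : IsArtinian R (R ⧸ P) := isArtinian_of_injective f hf
  have : IsArtinianRing (R ⧸ P) := isArtinian_of_tower R this
  have hPm : P.IsMaximal :=
    Ideal.Quotient.maximal_of_isField P (IsArtinianRing.isField_of_isDomain _)
  exact hPm.eq_of_le hQ.ne_top hPQ ▸ hPm

section AssociatedPrimes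

variable {R N : Type*} [CommRing R] [IsNoetherianRing R] [AddCommGroup N] [Module R N]

/-- If `z` avoids every associated prime of `N` inside the prime `Q`, then every element killed
by `z` is killed by some element outside `Q`. -/
theorem exists_notMem_smul_eq_zero {Q : Ideal R} [Q.IsPrime] {z : R}
    (hz : ∀ P ∈ associatedPrimes R N, P ≤ Q → z ∉ P) {v : N} (hv : z • v = 0) :
    ∃ s ∉ Q, s • v = 0 := by
  by_contra! hs
  have hle : Module.annihilator R (Submodule.span R {v}) ≤ Q := by
    intro a ha
    by_contra haQ
    refine hs a haQ ?_
    exact (Submodule.mem_annihilator_span_singleton v a).mp ha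
  obtain ⟨P, hP, hPQ⟩ := Ideal.exists_minimalPrimes_le hle
  have hPN : P ∈ associatedPrimes R N :=
    associatedPrimes.subset_of_injective (Submodule.injective_subtype _)
      (Module.associatedPrimes.minimalPrimes_annihilator_subset_associatedPrimes R _ hP)
  exact hz P hPN hPQ (hP.1.2 ((Submodule.mem_annihilator_span_singleton v z).mpr hv))

/-- Let `P` be an associated prime of `N` and `Q` a minimal prime of `P + (x)`. If no associated
prime of `N` strictly inside `Q` contains `x`, then `Q` is an associated prime of `N ⧸ xN`. -/
theorem mem_associatedPrimes_quotient_of_mem_minimalPrimes_sup [Module.Finite R N]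
    {P Q : Ideal R} {x : R} (hP : P ∈ associatedPrimes R N)
    (hQ : Q ∈ (P ⊔ Ideal.span {x}).minimalPrimes)
    (h : ∀ P' ∈ associatedPrimes R N, x ∈ P' → ¬ P' < Q) :
    Q ∈ associatedPrimes R (N ⧸ (Ideal.span {x} • (⊤ : Submodule R N))) := by
  have hPQ : P ≤ Q := le_sup_left.trans hQ.1.2
  have hxQ : x ∈ Q := hQ.1.2 (Ideal.mem_sup_right (Ideal.mem_span_singleton_self x))
  obtain ⟨K, hK⟩ := monotone_stabilizes_iff_noetherian.mpr (inferInstance : IsNoetherian R N)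
    ⟨fun n => LinearMap.ker (LinearMap.lsmul R N (x ^ n)), by
      intro a b hab n hn
      obtain ⟨c, rfl⟩ := Nat.exists_eq_add_of_le hab
      simp only [LinearMap.mem_ker, LinearMap.lsmul_apply] at hn ⊢
      rw [pow_add, mul_comm, mul_smul, hn, smul_zero]⟩
  have hstab : ∀ n : N, x ^ (K + 1) • n = 0 → x ^ K • n = 0 := by
    intro n hn
    have : n ∈ LinearMap.ker (LinearMap.lsmul R N (x ^ K)) := by
      have h' : LinearMap.ker (LinearMap.lsmul R N (x ^ K)) =
          LinearMap.ker (LinearMap.lsmul R N (x ^ (K + 1))) := hK (K + 1) (Nat.le_succ K)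
      rw [h']
      simpa using hn
    simpa using this
  let W : Submodule R N := LinearMap.ker (LinearMap.lsmul R N (x ^ K))
  have memW : ∀ n, n ∈ W ↔ x ^ K • n = 0 := fun n => by simp [W]
  let V : Submodule R N :=
    { carrier := {n | ∀ p ∈ P, p • n ∈ W}
      add_mem' := fun ha hb p hp => by rw [smul_add]; exact W.add_mem (ha p hp) (hb p hp)
      zero_mem' := fun p _ => by rw [smul_zero]; exact W.zero_mem
      smul_mem' := fun c n hn p hp => by rw [smul_comm]; exact W.smul_mem c (hn p hp) }
  have hV : ∀ n, x • n ∈ V → n ∈ V := by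
    intro n hn p hp
    rw [memW]
    apply hstab
    have := (memW _).mp (hn p hp)
    rwa [smul_comm p x, smul_smul, ← pow_succ] at this
  obtain ⟨hPp, u, hu⟩ := isAssociatedPrime_iff.mp hP
  have memP : ∀ a, a ∈ P ↔ a • u = 0 := fun a => by
    rw [hu, Submodule.mem_colon_singleton, Submodule.mem_bot]
  have huV : u ∈ V := fun p hp => by rw [(memP p).mp hp]; exact W.zero_mem
  have hannV : Module.annihilator R V ≤ P := fun a ha =>
    (memP a).mpr (congrArg Subtype.val (Module.mem_annihilator.mp ha ⟨u, huV⟩))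
  have hker : ∀ v : V, (v : N) ∈ Ideal.span {x} • (⊤ : Submodule R N) →
      v ∈ Ideal.span {x} • (⊤ : Submodule R V) := by
    intro v hv
    obtain ⟨n, hn⟩ := mem_span_singleton_smul_top.mp hv
    have hnV : n ∈ V := hV n (hn ▸ v.2)
    exact mem_span_singleton_smul_top.mpr ⟨⟨n, hnV⟩, Subtype.ext hn⟩
  let f := Submodule.mapQ (Ideal.span {x} • (⊤ : Submodule R V))
    (Ideal.span {x} • (⊤ : Submodule R N)) V.subtype (by
      rw [← Submodule.map_le_iff_le_comap, Submodule.map_smul'']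
      exact Submodule.smul_mono le_rfl le_top)
  have hf : Function.Injective f := by
    rw [← LinearMap.ker_eq_bot, LinearMap.ker_eq_bot']
    intro m hm
    obtain ⟨v, rfl⟩ := Submodule.Quotient.mk_surjective _ m
    rw [Submodule.mapQ_apply, Submodule.Quotient.mk_eq_zero] at hm
    exact (Submodule.Quotient.mk_eq_zero _).mpr (hker v hm)
  apply associatedPrimes.subset_of_injective hf
  apply Module.associatedPrimes.minimalPrimes_annihilator_subset_associatedPrimes
  have hsupp : ∀ q : PrimeSpectrum R,
      Module.annihilator R (V ⧸ (Ideal.span {x} • (⊤ : Submodule R V))) ≤ q.asIdeal ↔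
        Module.annihilator R V ≤ q.asIdeal ∧ x ∈ q.asIdeal := by
    intro q
    rw [← Module.mem_support_iff_of_finite, Module.support_quotient, Set.mem_inter_iff,
      Module.mem_support_iff_of_finite, PrimeSpectrum.mem_zeroLocus, SetLike.coe_subset_coe,
      Ideal.span_singleton_le_iff_mem]
  refine ⟨⟨hQ.1.1, (hsupp ⟨Q, hQ.1.1⟩).mpr ⟨hannV.trans hPQ, hxQ⟩⟩, ?_⟩
  rintro q ⟨hq, hqann⟩ hqQ
  obtain ⟨hqV, hxq⟩ := (hsupp ⟨q, hq⟩).mp hqann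
  have hmul : Module.annihilator R W * P ≤ q := by
    refine le_trans (Ideal.mul_le.mpr fun a ha p hp => ?_) hqV
    refine Module.mem_annihilator.mpr fun v => Subtype.ext ?_
    have := congrArg Subtype.val (Module.mem_annihilator.mp ha ⟨p • (v : N), v.2 p hp⟩)
    simpa [mul_smul] using this
  rcases hq.mul_le.mp hmul with hW | hPq
  · obtain ⟨P', hP', hP'q⟩ := Ideal.exists_minimalPrimes_le hW
    have hP'N : P' ∈ associatedPrimes R N :=
      associatedPrimes.subset_of_injective (Submodule.injective_subtype _)
        (Module.associatedPrimes.minimalPrimes_annihilator_subset_associatedPrimes R _ hP')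
    have hxP' : x ∈ P' := hP'.1.1.mem_of_pow_mem K (hP'.1.2 (Module.mem_annihilator.mpr
      fun w => Subtype.ext ((memW _).mp w.2)))
    have hP'Q : P' = Q := by
      by_contra hne
      exact h P' hP'N hxP' (lt_of_le_of_ne (hP'q.trans hqQ) hne)
    exact hP'Q ▸ hP'q
  · exact hQ.2 ⟨hq, sup_le hPq ((Ideal.span_singleton_le_iff_mem q).mpr hxq)⟩ hqQ

/-- If `x` is a nonzerodivisor on `N` and `y` one on `N ⧸ xN`, both locally at a prime `Q`, then
`Q` being associated to `N ⧸ yN` forces `x ∉ Q`. -/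
theorem notMem_of_mem_associatedPrimes_quotient {Q : Ideal R} {x y : R}
    (hx : ∀ P ∈ associatedPrimes R N, P ≤ Q → x ∉ P)
    (hy : ∀ P ∈ associatedPrimes R (N ⧸ (Ideal.span {x} • (⊤ : Submodule R N))), P ≤ Q → y ∉ P)
    (hQ : Q ∈ associatedPrimes R (N ⧸ (Ideal.span {y} • (⊤ : Submodule R N)))) : x ∉ Q := by
  intro hxQ
  obtain ⟨hQp, u', hu'⟩ := isAssociatedPrime_iff.mp hQ
  obtain ⟨u, rfl⟩ := Submodule.Quotient.mk_surjective _ u'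
  have memQ : ∀ a, a ∈ Q ↔ ∃ v, y • v = a • u := fun a => by
    rw [hu', Submodule.mem_colon_singleton, Submodule.mem_bot, ← Submodule.Quotient.mk_smul,
      Submodule.Quotient.mk_eq_zero, mem_span_singleton_smul_top]
  obtain ⟨v, hv⟩ := (memQ x).mp hxQ
  have hv0 : y • (Submodule.Quotient.mk v : N ⧸ (Ideal.span {x} • (⊤ : Submodule R N))) = 0 := by
    rw [← Submodule.Quotient.mk_smul, Submodule.Quotient.mk_eq_zero,
      mem_span_singleton_smul_top]
    exact ⟨u, hv.symm⟩
  obtain ⟨s, hs, hsv⟩ := exists_notMem_smul_eq_zero hy hv0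
  rw [← Submodule.Quotient.mk_smul, Submodule.Quotient.mk_eq_zero,
    mem_span_singleton_smul_top] at hsv
  obtain ⟨w, hw⟩ := hsv
  have hz : x • (s • u - y • w) = 0 := by
    rw [smul_sub, smul_comm x s, ← hv, smul_comm x y, hw, smul_comm s y, sub_self]
  obtain ⟨t, ht, htz⟩ := exists_notMem_smul_eq_zero hx hz
  have : t * s ∈ Q := (memQ _).mpr ⟨t • w, by
    rw [smul_sub, sub_eq_zero] at htz
    rw [mul_smul, htz, smul_comm]⟩
  exact (hQp.mem_or_mem this).elim ht hs

end AssociatedPrimes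

section Dimension

variable {R : Type*} [CommRing R]

theorem le_ringKrullDim_quotient_succ_of_lt {P Q : Ideal R} [P.IsPrime] (hPQ : P < Q)
    {k : ℕ} (hk : (k : WithBot ℕ∞) ≤ ringKrullDim (R ⧸ Q)) :
    ((k + 1 : ℕ) : WithBot ℕ∞) ≤ ringKrullDim (R ⧸ P) := by
  rw [ringKrullDim_quotient] at hk ⊢
  obtain ⟨l, hl⟩ := Order.le_krullDim_iff.mp hk
  refine Order.le_krullDim_iff.mpr ⟨(l.map (fun q => (⟨q.1, fun a ha => q.2 (hPQ.le ha)⟩ :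
    PrimeSpectrum.zeroLocus (R := R) P)) (fun _ _ hab => hab)).cons
      ⟨⟨P, inferInstance⟩, fun a ha => ha⟩ ?_, ?_⟩
  · exact hPQ.trans_le fun a ha => l.head.2 ha
  · simpa using! hl

theorem exists_minimalPrimes_le_ringKrullDim_quotient {J : Ideal R} {k : ℕ}
    (hk : (k : WithBot ℕ∞) ≤ ringKrullDim (R ⧸ J)) :
    ∃ Q ∈ J.minimalPrimes, (k : WithBot ℕ∞) ≤ ringKrullDim (R ⧸ Q) := by
  rw [ringKrullDim_quotient] at hk
  obtain ⟨l, hl⟩ := Order.le_krullDim_iff.mp hk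
  obtain ⟨Q, hQ, hQl⟩ := Ideal.exists_minimalPrimes_le (J := l.head.1.asIdeal) l.head.2
  refine ⟨Q, hQ, ?_⟩
  rw [ringKrullDim_quotient]
  refine Order.le_krullDim_iff.mpr ⟨⟨l.length, fun i => ⟨(l i).1, fun a ha =>
    l.head_le i (hQl ha)⟩, fun i => l.step i⟩, hl⟩

variable [IsNoetherianRing R] [IsLocalRing R]

theorem ringKrullDim_quotient_le_quotient_sup_span_add_card (P : Ideal R) (s : Finset R)
    (hs : ∀ a ∈ s, a ∈ maximalIdeal R) (hP : P ≠ ⊤) :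
    ringKrullDim (R ⧸ P) ≤ ringKrullDim (R ⧸ (P ⊔ Ideal.span (s : Set R))) + s.card := by
  classical
  have : Nontrivial (R ⧸ P) := Ideal.Quotient.nontrivial_iff.mpr hP
  have : IsLocalRing (R ⧸ P) :=
    IsLocalRing.of_surjective' (Ideal.Quotient.mk P) Ideal.Quotient.mk_surjective
  have h := ringKrullDim_le_ringKrullDim_quotient_add_card (s.image (Ideal.Quotient.mk P)) (by
    rw [IsLocalRing.ringJacobson_eq_maximalIdeal]
    intro b hb
    obtain ⟨a, ha, rfl⟩ := Finset.mem_image.mp hb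
    have hmax := Ideal.comap_isMaximal_of_surjective (Ideal.Quotient.mk P)
      Ideal.Quotient.mk_surjective (K := maximalIdeal (R ⧸ P))
    exact (IsLocalRing.eq_maximalIdeal hmax).ge (hs a ha))
  rw [Finset.coe_image, ← Ideal.map_span, ringKrullDim_eq_of_ringEquiv
    (DoubleQuot.quotQuotEquivQuotSup P (Ideal.span (s : Set R)))] at h
  refine h.trans ?_
  gcongr
  exact Finset.card_image_le

/-- A prime in the support of `M` containing `k` members of a system of parameters of `M` has
dimension at most `dim M - k`. -/
theorem IsSoP.ringKrullDim_quotient_le {M : Type*} [AddCommGroup M] [Module R M]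
    [Module.Finite R M] {d : ℕ} {y : Fin d → R} (hy : IsSoP R M y) {P : Ideal R} (hP : P.IsPrime)
    (hann : Module.annihilator R M ≤ P) {k : ℕ}
    (hyP : ∀ j : Fin d, (j : ℕ) < k → y j ∈ P) :
    ringKrullDim (R ⧸ P) ≤ ((d - k : ℕ) : WithBot ℕ∞) := by
  classical
  obtain ⟨hym, -, hfl⟩ := hy
  let t : Finset (Fin d) := Finset.univ.filter fun j => k ≤ (j : ℕ)
  let s : Finset R := t.image y
  have hcard : s.card ≤ d - k := by
    refine Finset.card_image_le.trans ?_
    have : t.map Fin.valEmbedding ⊆ Finset.Ico k d := by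
      intro j hj
      simp only [t, Finset.mem_map, Finset.mem_filter] at hj
      obtain ⟨i, ⟨-, hi⟩, rfl⟩ := hj
      exact Finset.mem_Ico.mpr ⟨hi, i.2⟩
    simpa using Finset.card_le_card this
  have hdim : ringKrullDim (R ⧸ (P ⊔ Ideal.span (s : Set R))) ≤ 0 := by
    rw [ringKrullDim_quotient, Order.krullDim_nonpos_iff_forall_isMax]
    have hmax : ∀ Q : PrimeSpectrum R,
        Q ∈ PrimeSpectrum.zeroLocus (R := R) (P ⊔ Ideal.span (s : Set R) : Ideal R) →
          Q.asIdeal.IsMaximal := by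
      intro Q hQ
      have hPQ : P ≤ Q.asIdeal := fun a ha => hQ (Ideal.mem_sup_left ha)
      have hsQ : ∀ a ∈ s, a ∈ Q.asIdeal := fun a ha =>
        hQ (Ideal.mem_sup_right (Ideal.subset_span ha))
      have := (isFiniteLength_iff_isNoetherian_isArtinian.mp hfl).2
      refine isMaximal_of_annihilator_le_of_isArtinian Q.2
        (M := M ⧸ (Ideal.span (Set.range y) • (⊤ : Submodule R M))) ?_
      rw [← Module.mem_support_iff_of_finite, Module.support_quotient]
      refine ⟨Module.mem_support_iff_of_finite.mpr (hann.trans hPQ), ?_⟩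
      rw [PrimeSpectrum.mem_zeroLocus, SetLike.coe_subset_coe, Ideal.span_le]
      rintro _ ⟨j, rfl⟩
      by_cases hj : (j : ℕ) < k
      · exact hPQ (hyP j hj)
      · exact hsQ _ (Finset.mem_image_of_mem y (by simpa [t] using hj))
    rintro ⟨Q, hQ⟩ ⟨Q', hQ'⟩ hle
    exact ((hmax Q hQ).eq_of_le Q'.2.ne_top hle).ge
  have h := ringKrullDim_quotient_le_quotient_sup_span_add_card P s (by
    intro a ha
    obtain ⟨j, -, rfl⟩ := Finset.mem_image.mp ha
    exact hym j) hP.ne_top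
  refine h.trans ((add_le_add hdim (Nat.cast_le.mpr hcard)).trans ?_)
  rw [zero_add]

/-- Exchange of two consecutive members of a reducing system of parameters. -/
theorem ringKrullDim_lt_of_mem_associatedPrimes_swap {N : Type*} [AddCommGroup N] [Module R N]
    [Module.Finite R N] {x y : R} (hxm : x ∈ maximalIdeal R) {k : ℕ}
    (hx : ∀ P ∈ associatedPrimes R N, x ∈ P →
      ringKrullDim (R ⧸ P) < ((k + 1 : ℕ) : WithBot ℕ∞))
    (hy : ∀ P ∈ associatedPrimes R (N ⧸ (Ideal.span {x} • (⊤ : Submodule R N))), y ∈ P →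
      ringKrullDim (R ⧸ P) < (k : WithBot ℕ∞)) :
    (∀ P ∈ associatedPrimes R N, y ∈ P →
      ringKrullDim (R ⧸ P) < ((k + 1 : ℕ) : WithBot ℕ∞)) ∧
    ∀ P ∈ associatedPrimes R (N ⧸ (Ideal.span {y} • (⊤ : Submodule R N))), x ∈ P →
      ringKrullDim (R ⧸ P) < (k : WithBot ℕ∞) := by
  have hlt : ∀ Q : Ideal R, (k : WithBot ℕ∞) ≤ ringKrullDim (R ⧸ Q) →
      ∀ P ∈ associatedPrimes R N, x ∈ P → ¬ P < Q := by
    intro Q hQ P hP hxP hPQ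
    have := hP.isPrime
    exact (hx P hP hxP).not_ge (le_ringKrullDim_quotient_succ_of_lt hPQ hQ)
  constructor
  · intro P hP hyP
    by_contra! hk
    have hdim := ringKrullDim_quotient_le_quotient_sup_span_add_card P {x} (by simpa using hxm)
      hP.isPrime.ne_top
    have hk' : (k : WithBot ℕ∞) ≤ ringKrullDim (R ⧸ (P ⊔ Ideal.span {x})) := by
      have h1 := hk.trans hdim
      rw [Finset.coe_singleton, Finset.card_singleton, Nat.cast_add] at h1
      exact (ENat.WithBot.add_le_add_natCast_right_iff (c := 1)).mp h1
    obtain ⟨Q, hQ, hQk⟩ := exists_minimalPrimes_le_ringKrullDim_quotient hk'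
    have hQN := mem_associatedPrimes_quotient_of_mem_minimalPrimes_sup hP hQ (hlt Q hQk)
    exact (hy Q hQN (hQ.1.2 (Ideal.mem_sup_left hyP))).not_ge hQk
  · intro Q hQ hxQ
    by_contra! hk
    have hQp := hQ.isPrime
    have hmono : ∀ P ≤ Q, (k : WithBot ℕ∞) ≤ ringKrullDim (R ⧸ P) := fun P hP =>
      hk.trans (ringKrullDim_le_of_surjective (Ideal.Quotient.factor hP)
        (Ideal.Quotient.factor_surjective hP))
    have hyQ : y ∈ Q := by
      have := IsAssociatedPrime.annihilator_le hQ
      refine this (Submodule.mem_annihilator.mpr fun n _ => ?_)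
      obtain ⟨n, rfl⟩ := Submodule.Quotient.mk_surjective _ n
      rw [← Submodule.Quotient.mk_smul, Submodule.Quotient.mk_eq_zero]
      exact Submodule.smul_mem_smul (Ideal.mem_span_singleton_self y) trivial
    refine notMem_of_mem_associatedPrimes_quotient (fun P hP hPQ hxP => ?_)
      (fun P hP hPQ hyP => (hy P hP hyP).not_ge (hmono P hPQ)) hQ hxQ
    rcases hPQ.lt_or_eq with h | rfl
    · exact hlt Q hk P hP hxP h
    · have hPN := mem_associatedPrimes_quotient_of_mem_minimalPrimes_sup (x := x) hP (by
        rw [sup_eq_left.mpr ((Ideal.span_singleton_le_iff_mem P).mpr hxQ),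
          Ideal.minimalPrimes_eq_subsingleton_self]
        rfl) (hlt P hk)
      exact (hy P hPN hyQ).not_ge hk

end Dimension

section Permutation

variable {R M : Type*} [CommRing R] [IsLocalRing R] [AddCommGroup M] [Module R M] {d : ℕ}

theorem IsSoP.comp_perm {y : Fin d → R} (hy : IsSoP R M y) (π : Equiv.Perm (Fin d)) :
    IsSoP R M (y ∘ π) :=
  ⟨fun i => hy.1 (π i), hy.2.1, by rw [π.surjective.range_comp]; exact hy.2.2⟩

theorem IsReducingSoP.ringKrullDim_quotient_lt [IsNoetherianRing R] [Module.Finite R M]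
    {y : Fin d → R} (hy : IsReducingSoP R M y) {i : Fin d} (hi : (i : ℕ) < d - 1) {P : Ideal R}
    (hP : P ∈ associatedPrimes R
      (M ⧸ (Ideal.span (y '' {j : Fin d | (j : ℕ) < (i : ℕ)}) • (⊤ : Submodule R M))))
    (hyP : y i ∈ P) :
    ringKrullDim (R ⧸ P) < ((d - ((i : ℕ) + 1) : ℕ) : WithBot ℕ∞) := by
  have hle := IsAssociatedPrime.annihilator_le hP
  rw [Submodule.annihilator_top] at hle
  have hann := (Module.mem_support_iff_of_finite (p := ⟨P, hP.isPrime⟩)).mpr hle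
  rw [Module.support_quotient] at hann
  refine lt_of_le_of_ne (hy.1.ringKrullDim_quotient_le hP.isPrime
    (Module.mem_support_iff_of_finite.mp hann.1) (k := i + 1) fun j hj => ?_)
    fun h => hy.2 i hi P hP h hyP
  rcases (Nat.lt_succ_iff.mp hj).lt_or_eq with h | h
  · exact hann.2 (Ideal.subset_span ⟨j, h, rfl⟩)
  · rwa [Fin.ext h]

theorem IsReducingSoP.comp_swap [IsNoetherianRing R] [Module.Finite R M]
    {y : Fin d → R} (hy : IsReducingSoP R M y) {a b : Fin d} (hab : (b : ℕ) = a + 1)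
    (hb : (b : ℕ) < d - 1) : IsReducingSoP R M (y ∘ Equiv.swap a b) := by
  have hne : a ≠ b := fun h => by simp [h] at hab
  have himage : ∀ s : Set (Fin d), (a ∈ s ↔ b ∈ s) → (y ∘ Equiv.swap a b) '' s = y '' s := by
    intro s hs
    rw [Set.image_comp]
    congr 1
    ext j
    rw [Equiv.image_eq_preimage_symm, Equiv.symm_swap, Set.mem_preimage]
    by_cases hja : j = a
    · rw [hja, Equiv.swap_apply_left, hs]
    by_cases hjb : j = b
    · rw [hjb, Equiv.swap_apply_right, hs]
    rw [Equiv.swap_apply_of_ne_of_ne hja hjb]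
  have hset : {j : Fin d | (j : ℕ) < (b : ℕ)} = insert a {j : Fin d | (j : ℕ) < (a : ℕ)} := by
    ext j
    simp only [Set.mem_ofPred_eq, Set.mem_insert_iff, Fin.ext_iff]
    omega
  have hspan : ∀ z : Fin d → R, Ideal.span (z '' {j : Fin d | (j : ℕ) < (b : ℕ)}) =
      Ideal.span (z '' {j : Fin d | (j : ℕ) < (a : ℕ)}) ⊔ Ideal.span {z a} := by
    intro z
    rw [hset, Set.image_insert_eq, Ideal.span_insert, sup_comm]
  have hIa := himage {j : Fin d | (j : ℕ) < (a : ℕ)} (by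
    simp only [Set.mem_ofPred_eq]; omega)
  have hk : d - ((a : ℕ) + 1) = d - ((b : ℕ) + 1) + 1 := by omega
  have key := ringKrullDim_lt_of_mem_associatedPrimes_swap
    (N := M ⧸ (Ideal.span (y '' {j : Fin d | (j : ℕ) < (a : ℕ)}) • (⊤ : Submodule R M)))
    (k := d - ((b : ℕ) + 1)) (hy.1.1 a)
    (fun P hP hyP => hk ▸ hy.ringKrullDim_quotient_lt (by omega) hP hyP)
    (y := y b) (fun P hP hyP => hy.ringKrullDim_quotient_lt hb (by
      rwa [hspan y, associatedPrimes_quotient_sup_span_singleton]) hyP)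
  refine ⟨hy.1.comp_perm _, fun i hi P hP hdim hiP => ?_⟩
  by_cases hia : i = a
  · subst hia
    rw [hIa] at hP
    rw [Function.comp_apply, Equiv.swap_apply_left] at hiP
    exact (key.1 P hP hiP).ne (hk ▸ hdim)
  by_cases hib : i = b
  · subst hib
    rw [hspan, hIa, associatedPrimes_quotient_sup_span_singleton, Function.comp_apply,
      Equiv.swap_apply_left] at hP
    rw [Function.comp_apply, Equiv.swap_apply_right] at hiP
    exact (key.2 P hP hiP).ne hdim
  · rw [himage _ (by
      rw [Fin.ext_iff] at hia hib
      simp only [Set.mem_ofPred_eq]; omega)] at hP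
    rw [Function.comp_apply, Equiv.swap_apply_of_ne_of_ne hia hib] at hiP
    exact hy.2 i hi P hP hdim hiP

theorem IsPartReducingSoP.comp_swap [IsNoetherianRing R] [Module.Finite R M] {r : ℕ}
    (hd : moduleDim R M = (d : ℕ)) (hr : r < d) {x : Fin r → R} (hx : IsPartReducingSoP R M x)
    {a b : Fin r} (hab : (b : ℕ) = a + 1) : IsPartReducingSoP R M (x ∘ Equiv.swap a b) := by
  obtain ⟨d', hrd, y, hy, hyx⟩ := hx
  have hdd : d = d' := by
    have := hd.symm.trans hy.1.2.1
    exact_mod_cast this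
  subst hdd
  refine ⟨d, hrd, _, hy.comp_swap (a := Fin.castLE hrd a) (b := Fin.castLE hrd b) hab
    (by have := b.2; simp only [Fin.val_castLE]; omega), fun i => ?_⟩
  rw [Function.comp_apply, Function.comp_apply, ← hyx,
    (Fin.castLE_injective hrd).map_swap]

end Permutation

theorem stmt4 (R M : Type*) [CommRing R] [IsLocalRing R] [IsNoetherianRing R]
    [AddCommGroup M] [Module R M] [Module.Finite R M] [Nontrivial M]
    {d r : ℕ} (hd : moduleDim R M = (d : ℕ)) (hr : r < d)
    (x : Fin r → R) (hx : IsPartReducingSoP R M x) (π : Equiv.Perm (Fin r)) :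
    IsPartReducingSoP R M (x ∘ π) := by
  cases r with
  | zero => rwa [Subsingleton.elim (x ∘ π) x]
  | succ n =>
    have hπ : π ∈ Submonoid.closure
        (Set.range fun i : Fin n => Equiv.swap i.castSucc i.succ) := by
      rw [Equiv.Perm.mclosure_swap_castSucc_succ]
      trivial
    induction hπ using Submonoid.closure_induction generalizing x with
    | mem π hπ =>
      obtain ⟨i, rfl⟩ := hπ
      exact hx.comp_swap hd hr (by simp)
    | one => exact hx
    | mul σ τ _ _ hσ hτ => exact hτ _ (hσ x hx)
end

section
/- Let x ∈ R be a zero divisor on M. Then every prime P that is minimal among the primes in Ass M ∩ V(x) is an associated prime of M/xM. -/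
open IsLocalRing

/-- Some element outside a minimal prime `P` of `I` multiplies a power of `P` into `I`. -/
theorem exists_notMem_forall_mul_mem_of_mem_minimalPrimes {R : Type*} [CommRing R]
    [IsNoetherianRing R] {I P : Ideal R} (hP : P ∈ I.minimalPrimes) :
    ∃ s ∉ P, ∃ n : ℕ, ∀ a ∈ P ^ n, s * a ∈ I := by
  have hprime : P.IsPrime := hP.1.1
  have hfin := Ideal.finite_minimalPrimes_of_isNoetherianRing R I
  obtain ⟨s, hs, hsP⟩ : ∃ s, (∀ Q ∈ I.minimalPrimes, Q ≠ P → s ∈ Q) ∧ s ∉ P := by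
    by_contra! h
    obtain ⟨Q, hQ, hQP⟩ := (hprime.inf_le' (s := (hfin.sdiff (t := {P})).toFinset) (f := id)).1
      (fun s hs ↦ h s fun Q hQ hne ↦ by
        rw [Submodule.mem_finsetInf] at hs
        exact hs Q (by simpa using ⟨hQ, hne⟩))
    have hQ' : Q ∈ I.minimalPrimes ∧ Q ≠ P := by simpa using hQ
    exact hQ'.2 (le_antisymm hQP (hP.2 hQ'.1.1 hQP))
  have hle : Ideal.span {s} * P ≤ I.radical := by
    rw [Ideal.span_singleton_mul_le_iff, ← Ideal.sInf_minimalPrimes]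
    intro a ha
    rw [Submodule.mem_sInf]
    intro Q hQ
    by_cases hQP : Q = P
    · exact hQP ▸ P.mul_mem_left s ha
    · exact Ideal.mul_mem_right a Q (hs Q hQ hQP)
  obtain ⟨n, hn⟩ := I.exists_radical_pow_le_of_fg (IsNoetherian.noetherian _)
  refine ⟨s ^ n, fun h ↦ hsP (hprime.mem_of_pow_mem n h), n, fun a ha ↦ ?_⟩
  have h := (Ideal.pow_right_mono hle n).trans hn
  rw [mul_pow, Ideal.span_singleton_pow, Ideal.span_singleton_mul_le_iff] at h
  exact h a ha

/-- The submodule of elements `m` such that `s • m` is killed by the ideal `I`. -/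
def smulTorsionBy {R : Type*} (M : Type*) [CommRing R] [AddCommGroup M] [Module R M]
    (I : Ideal R) (s : R) : Submodule R M where
  carrier := {m | ∀ a ∈ I, (s * a) • m = 0}
  zero_mem' := fun a _ ↦ smul_zero _
  add_mem' := fun hm hn a ha ↦ by rw [smul_add, hm a ha, hn a ha, add_zero]
  smul_mem' := fun c m hm a ha ↦ by rw [smul_comm, hm a ha, smul_zero]

/-- Among the submodules `smulTorsionBy M (P ^ n) s` with `s ∉ P` there is a largest one. -/
theorem exists_smulTorsionBy_pow_greatest {R : Type*} (M : Type*) [CommRing R] [AddCommGroup M]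
    [Module R M] [IsNoetherian R M] (P : Ideal R) [hP : P.IsPrime] :
    ∃ t ∉ P, ∃ k : ℕ, ∀ s ∉ P, ∀ n : ℕ,
      smulTorsionBy M (P ^ n) s ≤ smulTorsionBy M (P ^ k) t := by
  obtain ⟨_, ⟨t, ht, k, rfl⟩, hmax⟩ := (wellFounded_gt (α := Submodule R M)).has_min
    {N | ∃ t ∉ P, ∃ k : ℕ, smulTorsionBy M (P ^ k) t = N}
    ⟨_, 1, hP.one_notMem, 0, rfl⟩
  refine ⟨t, ht, k, fun s hs n ↦ ?_⟩
  have hle : smulTorsionBy M (P ^ k) t ≤ smulTorsionBy M (P ^ (k + n)) (s * t) :=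
    fun m hm a ha ↦ by
      rw [mul_assoc, mul_smul, hm a (Ideal.pow_le_pow_right (Nat.le_add_right k n) ha), smul_zero]
  have hle' : smulTorsionBy M (P ^ n) s ≤ smulTorsionBy M (P ^ (k + n)) (s * t) :=
    fun m hm a ha ↦ by
      rw [mul_comm s, mul_assoc, mul_smul,
        hm a (Ideal.pow_le_pow_right (Nat.le_add_left n k) ha), smul_zero]
  rw [eq_of_le_of_not_lt hle
    (hmax _ ⟨s * t, hP.mul_notMem hs ht, k + n, rfl⟩)]
  exact hle'

/-- If `P` is minimal among the associated primes of `M` containing `x`, then `P` is a minimal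
prime of the annihilator of the kernel of multiplication by `x`. -/
theorem mem_minimalPrimes_annihilator_ker_lsmul {R M : Type*} [CommRing R] [IsNoetherianRing R]
    [AddCommGroup M] [Module R M] [Module.Finite R M] {x : R} {P : Ideal R}
    (hP : P ∈ associatedPrimes R M) (hxP : x ∈ P)
    (hmin : ∀ Q ∈ associatedPrimes R M, x ∈ Q → Q ≤ P → Q = P) :
    P ∈ (Module.annihilator R (LinearMap.ker (LinearMap.lsmul R M x))).minimalPrimes := by
  set N := LinearMap.ker (LinearMap.lsmul R M x)
  obtain ⟨hprime, m, hm⟩ := isAssociatedPrime_iff.1 hP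
  have hmem (a : R) : a ∈ P ↔ a • m = 0 := by
    rw [hm, Submodule.mem_colon_singleton, Submodule.mem_bot]
  have hle : Module.annihilator R N ≤ P := fun a ha ↦ by
    have h := Module.mem_annihilator.1 ha ⟨m, (hmem x).1 hxP⟩
    exact (hmem a).2 (congrArg Subtype.val h)
  obtain ⟨Q, hQ, hQP⟩ := Ideal.exists_minimalPrimes_le hle
  have hxQ : x ∈ Q := hQ.1.2 <| Module.mem_annihilator.2 fun n ↦ Subtype.ext n.2
  have hQM : Q ∈ associatedPrimes R M :=
    associatedPrimes.subset_of_injective (f := N.subtype) N.injective_subtype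
      (Module.associatedPrimes.minimalPrimes_annihilator_subset_associatedPrimes R N hQ)
  exact hmin Q hQM hxQ hQP ▸ hQ

theorem stmt7 (R M : Type*) [CommRing R] [IsLocalRing R] [IsNoetherianRing R]
    [AddCommGroup M] [Module R M] [Module.Finite R M] [Nontrivial M]
    (x : R) (hx : ∃ m : M, m ≠ 0 ∧ x • m = 0) (P : Ideal R)
    (hP : P ∈ associatedPrimes R M) (hxP : x ∈ P)
    (hmin : ∀ Q ∈ associatedPrimes R M, x ∈ Q → Q ≤ P → Q = P) :
    P ∈ associatedPrimes R (M ⧸ (Ideal.span {x} • (⊤ : Submodule R M))) := by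
  obtain ⟨hprime, m₀, hm₀⟩ := isAssociatedPrime_iff.1 hP
  have hann (a : R) : a ∈ P ↔ a • m₀ = 0 := by
    rw [hm₀, Submodule.mem_colon_singleton, Submodule.mem_bot]
  obtain ⟨t, ht, k, hmax⟩ := exists_smulTorsionBy_pow_greatest M P
  obtain ⟨s, hs, l, hsl⟩ := exists_notMem_forall_mul_mem_of_mem_minimalPrimes
    (mem_minimalPrimes_annihilator_ker_lsmul hP hxP hmin)
  have hm₀Γ : m₀ ∈ smulTorsionBy M (P ^ k) t :=
    hmax 1 hprime.one_notMem 1 fun a ha ↦ by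
      rw [one_mul]
      exact (hann a).1 (by simpa using ha)
  have hdiv (m : M) (hm : x • m ∈ smulTorsionBy M (P ^ k) t) :
      m ∈ smulTorsionBy M (P ^ k) t := by
    refine hmax (s * t) (hprime.mul_notMem hs ht) (l + k) fun c hc ↦ ?_
    rw [pow_add] at hc
    refine Submodule.mul_induction_on hc (fun b hb a ha ↦ ?_) fun a b ha hb ↦ ?_
    · have hker : x • (t * a) • m = 0 := by rw [smul_comm, hm a ha]
      have h := congrArg Subtype.val (Module.mem_annihilator.1 (hsl b hb) ⟨(t * a) • m, hker⟩)
      rw [mul_mul_mul_comm, mul_smul]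
      exact h
    · rw [mul_add, add_smul, ha, hb, add_zero]
  obtain ⟨g, hg, hgx⟩ : ∃ g ∈ smulTorsionBy M (P ^ k) t, ∀ r ∉ P, ∀ m, r • g ≠ x • m := by
    by_contra! h
    have hpow (j : ℕ) : ∃ r ∉ P, ∃ m ∈ smulTorsionBy M (P ^ k) t, r • m₀ = x ^ j • m := by
      induction j with
      | zero => exact ⟨1, hprime.one_notMem, m₀, hm₀Γ, by simp⟩
      | succ j ih =>
        obtain ⟨r, hr, m, hm, hrm⟩ := ih
        obtain ⟨r', hr', m', hm'⟩ := h m hm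
        refine ⟨r' * r, hprime.mul_notMem hr' hr, m',
          hdiv m' (hm' ▸ Submodule.smul_mem _ r' hm), ?_⟩
        rw [mul_smul, hrm, smul_comm, hm', pow_succ, mul_smul]
    obtain ⟨r, hr, m, hm, hrm⟩ := hpow k
    refine hprime.mul_notMem ht hr ((hann _).2 ?_)
    rw [mul_smul, hrm, ← mul_smul, hm _ (Ideal.pow_mem_pow hxP k)]
  have hcolon (a : R) : a ∈ (⊥ : Submodule R (M ⧸ (Ideal.span {x} • (⊤ : Submodule R M)))).colon
      {Submodule.Quotient.mk (t • g)} ↔ ∃ m, x • m = (a * t) • g := by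
    rw [Submodule.mem_colon_singleton, Submodule.mem_bot, ← Submodule.Quotient.mk_smul,
      Submodule.Quotient.mk_eq_zero, Submodule.ideal_span_singleton_smul,
      Submodule.mem_smul_pointwise_iff_exists, mul_smul]
    simp
  refine ⟨hprime, Submodule.Quotient.mk (t • g), le_antisymm (fun a ha ↦ ⟨k, (hcolon _).2 ⟨0, ?_⟩⟩) ?_⟩
  · refine hprime.radical_le_iff.2 fun a ha ↦ ?_
    obtain ⟨m, hm⟩ := (hcolon a).1 ha
    by_contra haP
    exact hgx (a * t) (hprime.mul_notMem haP ht) m hm.symm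
  · rw [smul_zero, mul_comm, hg _ (Ideal.pow_mem_pow ha k)]
end

section
/- Let Q ∈ Supp M and suppose there exists x ∈ 𝔪 with x ∉ Q. Then there exists a prime P ∈ Supp M with x ∈ P, Q ⊊ P, and dim R/P = dim R/Q − 1. -/
open IsLocalRing

/-- The Krull dimension of `R ⧸ I`, when finite, is attained at a prime containing `I`. -/
lemma exists_prime_le_ringKrullDim_quotient_eq {R : Type*} [CommRing R] (I : Ideal R)
    [FiniteRingKrullDim (R ⧸ I)] :
    ∃ P : PrimeSpectrum R, I ≤ P.asIdeal ∧
      ringKrullDim (R ⧸ P.asIdeal) = ringKrullDim (R ⧸ I) := by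
  let l := (LTSeries.longestOf (PrimeSpectrum (R ⧸ I))).map
    I.primeSpectrumQuotientOrderIsoZeroLocus I.primeSpectrumQuotientOrderIsoZeroLocus.strictMono
  have hI : I ≤ l.head.1.asIdeal := l.head.2
  refine ⟨l.head.1, hI, le_antisymm
    (ringKrullDim_le_of_surjective _ (Ideal.Quotient.factor_surjective hI)) ?_⟩
  let s : LTSeries (PrimeSpectrum.zeroLocus (l.head.1.asIdeal : Set R)) :=
    ⟨l.length, fun i ↦ ⟨(l i).1, l.head_le i⟩, fun i ↦ l.step i⟩
  rw [ringKrullDim_quotient l.head.1.asIdeal, ringKrullDim,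
    Order.krullDim_eq_length_of_finiteDimensionalOrder]
  exact Order.LTSeries.length_le_krullDim s

/-- Cutting `R ⧸ Q` by an element of the maximal ideal outside the prime `Q` lowers the
dimension by exactly one. -/
lemma ringKrullDim_quotient_sup_span_singleton_add_one {R : Type*} [CommRing R] [IsLocalRing R]
    [IsNoetherianRing R] (Q : Ideal R) [Q.IsPrime] {x : R} (hx : x ∈ maximalIdeal R)
    (hxQ : x ∉ Q) :
    ringKrullDim (R ⧸ Q ⊔ Ideal.span {x}) + 1 = ringKrullDim (R ⧸ Q) := by
  have : IsLocalRing (R ⧸ Q) := .of_surjective' _ Ideal.Quotient.mk_surjective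
  rw [← ringKrullDim_eq_of_ringEquiv (DoubleQuot.quotQuotEquivQuotSup Q (Ideal.span {x})),
    Ideal.map_span, Set.image_singleton]
  refine ringKrullDim_quotient_span_singleton_succ_eq_ringKrullDim_of_mem_nonZeroDivisors
    (mem_nonZeroDivisors_of_ne_zero (by rwa [Ne, Ideal.Quotient.eq_zero_iff_mem])) ?_
  have : IsLocalHom (Ideal.Quotient.mk Q) := .of_surjective _ Ideal.Quotient.mk_surjective
  exact map_nonunit _ x hx

theorem stmt8 (R M : Type*) [CommRing R] [IsLocalRing R] [IsNoetherianRing R]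
    [AddCommGroup M] [Module R M] [Module.Finite R M] [Nontrivial M]
    (Q : PrimeSpectrum R) (hQ : Q ∈ Module.support R M) (x : R)
    (hx : x ∈ maximalIdeal R) (hxQ : x ∉ Q.asIdeal) :
    ∃ P : PrimeSpectrum R, P ∈ Module.support R M ∧ x ∈ P.asIdeal ∧
      Q.asIdeal < P.asIdeal ∧
      ringKrullDim (R ⧸ P.asIdeal) + 1 = ringKrullDim (R ⧸ Q.asIdeal) := by
  have hI : Q.asIdeal ⊔ Ideal.span {x} ≤ maximalIdeal R :=
    sup_le (le_maximalIdeal Q.2.ne_top) ((Ideal.span_singleton_le_iff_mem _).mpr hx)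
  have : Nontrivial (R ⧸ Q.asIdeal ⊔ Ideal.span {x}) :=
    Ideal.Quotient.nontrivial_iff.mpr fun h ↦
      (maximalIdeal.isMaximal R).ne_top (top_le_iff.mp (h ▸ hI))
  have : IsLocalRing (R ⧸ Q.asIdeal ⊔ Ideal.span {x}) :=
    .of_surjective' _ Ideal.Quotient.mk_surjective
  obtain ⟨P, hP, hdim⟩ :=
    exists_prime_le_ringKrullDim_quotient_eq (Q.asIdeal ⊔ Ideal.span {x})
  have hQP : Q.asIdeal ≤ P.asIdeal := le_sup_left.trans hP
  have hxP : x ∈ P.asIdeal := hP (Ideal.mem_sup_right (Ideal.mem_span_singleton_self x))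
  refine ⟨P, Module.mem_support_mono hQP hQ, hxP, hQP.lt_of_ne fun h ↦ hxQ (h ▸ hxP), ?_⟩
  rw [hdim, ringKrullDim_quotient_sup_span_singleton_add_one Q.asIdeal hx hxQ]
end

section
/- Let d = dim_R M ≥ 2 and let x ∈ 𝔪 be such that (x) is part of a system of parameters of M. Then (x) is part of a reducing system of parameters of M if and only if for every prime P ∈ Supp M ∩ V(x) with dim R/P = d−1, the localization M_P is a one-dimensional Cohen–Macaulay module over R_P. -/
open IsLocalRing

open Module

theorem moduleDim_eq_supportDim (R M : Type*) [CommRing R] [AddCommGroup M] [Module R M]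
    [Module.Finite R M] : moduleDim R M = supportDim R M :=
  (supportDim_eq_ringKrullDim_quotient_annihilator R M).symm

theorem ringKrullDim_quotient_le_supportDim {R M : Type*} [CommRing R] [AddCommGroup M]
    [Module R M] [Module.Finite R M] {P : PrimeSpectrum R} (hP : P ∈ support R M) :
    ringKrullDim (R ⧸ P.asIdeal) ≤ supportDim R M := by
  rw [supportDim_eq_ringKrullDim_quotient_annihilator]
  exact ringKrullDim_le_of_surjective
    (Ideal.Quotient.factor (annihilator_le_of_mem_support hP))
    (Ideal.Quotient.factor_surjective _)

theorem eq_of_le_of_ringKrullDim_quotient_le {R : Type*} [CommRing R] {P Q : Ideal R} [Q.IsPrime]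
    (hQP : Q ≤ P) {n : ℕ} (hP : ringKrullDim (R ⧸ P) = n) (hQ : ringKrullDim (R ⧸ Q) ≤ n) :
    Q = P := by
  by_contra hne
  obtain ⟨r, hrP, hrQ⟩ := Set.exists_of_ssubset (hQP.lt_of_ne hne)
  have h := ringKrullDim_succ_le_of_surjective (Ideal.Quotient.factor hQP)
    (Ideal.Quotient.factor_surjective _) (r := Ideal.Quotient.mk Q r)
    (mem_nonZeroDivisors_of_ne_zero (by rwa [Ne, Ideal.Quotient.eq_zero_iff_mem]))
    (by simpa [Ideal.Quotient.eq_zero_iff_mem] using hrP)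
  rw [hP] at h
  have := h.trans hQ
  norm_cast at this
  omega

theorem supportDim_nonpos_of_forall_mem_support {R M : Type*} [CommRing R] [IsLocalRing R]
    [AddCommGroup M] [Module R M] (h : ∀ P ∈ support R M, P.asIdeal = maximalIdeal R) :
    supportDim R M ≤ 0 := by
  have : Subsingleton (support R M) :=
    ⟨fun P Q ↦ Subtype.ext (PrimeSpectrum.ext ((h P P.2).trans (h Q Q.2).symm))⟩
  exact Order.krullDim_nonpos_of_subsingleton

theorem IsFiniteLength.supportDim_nonpos {R M : Type*} [CommRing R] [IsLocalRing R]
    [IsNoetherianRing R] [AddCommGroup M] [Module R M] [Module.Finite R M]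
    (h : IsFiniteLength R M) : supportDim R M ≤ 0 := by
  obtain ⟨-, _⟩ := isFiniteLength_iff_isNoetherian_isArtinian.mp h
  refine supportDim_nonpos_of_forall_mem_support fun P hP ↦ ?_
  obtain ⟨Q, hQ, hQP⟩ := Ideal.exists_minimalPrimes_le (annihilator_le_of_mem_support hP)
  obtain ⟨hQ', f, hf⟩ := (isAssociatedPrime_iff_exists_injective_linearMap Q M).mp
    (associatedPrimes.minimalPrimes_annihilator_subset_associatedPrimes R M hQ)
  have : IsArtinian R (R ⧸ Q) := isArtinian_of_injective f hf
  have : IsArtinianRing (R ⧸ Q) := isArtinian_of_tower R this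
  have hm : Q.IsMaximal :=
    Ideal.Quotient.maximal_of_isField _ (IsArtinianRing.isField_of_isDomain _)
  rw [← IsLocalRing.eq_maximalIdeal hm]
  exact (hm.eq_of_le P.2.ne_top hQP).symm

theorem isFiniteLength_of_supportDim_nonpos {R M : Type*} [CommRing R] [IsNoetherianRing R]
    [AddCommGroup M] [Module R M] [Module.Finite R M] (h : supportDim R M ≤ 0) :
    IsFiniteLength R M := by
  rw [supportDim_eq_ringKrullDim_quotient_annihilator] at h
  have : Ring.KrullDimLE 0 (R ⧸ annihilator R M) := Order.krullDimLE_iff _ _ |>.mpr h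
  have : IsArtinianRing (R ⧸ annihilator R M) := isArtinianRing_iff_krullDimLE_zero.mpr this
  let := Module.quotientAnnihilator (R := R) (M := M)
  have : Module.Finite (R ⧸ annihilator R M) M := Module.Finite.of_restrictScalars_finite R _ _
  refine isFiniteLength_iff_isNoetherian_isArtinian.mpr ⟨inferInstance, ?_⟩
  exact isArtinian_of_surjective_algebraMap (R := R ⧸ annihilator R M)
    Ideal.Quotient.mk_surjective

theorem supportDim_quotient_sup_span_singleton {R M : Type*} [CommRing R] [AddCommGroup M]
    [Module R M] [Module.Finite R M] (I : Ideal R) (a : R) :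
    supportDim R (M ⧸ (I ⊔ Ideal.span {a}) • (⊤ : Submodule R M)) =
      supportDim R (QuotSMulTop a (M ⧸ I • (⊤ : Submodule R M))) := by
  have : support R (M ⧸ (I ⊔ Ideal.span {a}) • (⊤ : Submodule R M)) =
      support R (QuotSMulTop a (M ⧸ I • (⊤ : Submodule R M))) := by
    rw [support_quotient, support_quotSMulTop, support_quotient,
      PrimeSpectrum.zeroLocus_sup, PrimeSpectrum.zeroLocus_span, Set.inter_assoc]
  rw [supportDim, supportDim, this]

theorem supportDim_quotient_bot_smul_top {R M : Type*} [CommRing R] [AddCommGroup M]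
    [Module R M] :
    supportDim R (M ⧸ (⊥ : Ideal R) • (⊤ : Submodule R M)) = supportDim R M :=
  supportDim_eq_of_equiv (Submodule.quotEquivOfEqBot _ (by simp))

theorem supportDim_quotient_le_add_card {R M : Type*} [CommRing R] [IsLocalRing R]
    [IsNoetherianRing R] [AddCommGroup M] [Module R M] [Module.Finite R M] (I : Ideal R)
    (s : Finset R) (hs : ∀ a ∈ s, a ∈ maximalIdeal R) :
    supportDim R (M ⧸ I • (⊤ : Submodule R M)) ≤
      supportDim R (M ⧸ (I ⊔ Ideal.span (s : Set R)) • (⊤ : Submodule R M)) + s.card := by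
  classical
  induction s using Finset.induction_on with
  | empty => rw [Finset.coe_empty, Ideal.span_empty, sup_bot_eq]; simp
  | insert a s ha ih =>
    simp only [Finset.mem_insert, forall_eq_or_imp] at hs
    refine (ih hs.2).trans ?_
    rw [Finset.coe_insert, Ideal.span_insert, sup_comm (Ideal.span {a}), ← sup_assoc,
      supportDim_quotient_sup_span_singleton, Finset.card_insert_of_notMem ha, Nat.cast_add,
      add_comm (s.card : WithBot ℕ∞), ← add_assoc]
    exact add_le_add_left (supportDim_le_supportDim_quotSMulTop_succ hs.1) _

theorem exists_notMem_associatedPrimes_supportDim_quotSMulTop {R M : Type*} [CommRing R]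
    [IsLocalRing R] [IsNoetherianRing R] [AddCommGroup M] [Module R M] [Module.Finite R M] {n : ℕ}
    (h : supportDim R M = (n + 1 : ℕ)) :
    ∃ a ∈ maximalIdeal R, (∀ P ∈ associatedPrimes R M, P ≠ maximalIdeal R → a ∉ P) ∧
      supportDim R (QuotSMulTop a M) = n := by
  have hfin : (associatedPrimes R M \ {maximalIdeal R}).Finite :=
    (associatedPrimes.finite R M).sdiff
  have hex : ∃ a ∈ maximalIdeal R, ∀ P ∈ associatedPrimes R M, P ≠ maximalIdeal R → a ∉ P := by
    by_contra! hcon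
    have hsub : (maximalIdeal R : Set R) ⊆ ⋃ P ∈ associatedPrimes R M \ {maximalIdeal R}, P := by
      intro a ha
      obtain ⟨P, hP, hne, haP⟩ := hcon a ha
      exact Set.mem_biUnion (⟨hP, hne⟩ : P ∈ associatedPrimes R M \ {maximalIdeal R}) haP
    obtain ⟨P, hP, hle⟩ := (Ideal.subset_union_prime_finite hfin (f := id) ⊥ ⊥
      fun P hP _ _ ↦ IsAssociatedPrime.isPrime hP.1).mp hsub
    exact hP.2 ((le_maximalIdeal (IsAssociatedPrime.isPrime hP.1).ne_top).antisymm hle)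
  obtain ⟨a, ha, haP⟩ := hex
  refine ⟨a, ha, haP, ?_⟩
  have hmin : ∀ p ∈ (annihilator R M).minimalPrimes, a ∉ p := by
    intro p hp
    refine haP p (associatedPrimes.minimalPrimes_annihilator_subset_associatedPrimes R M hp) ?_
    rintro rfl
    have h0 : supportDim R M ≤ 0 := supportDim_nonpos_of_forall_mem_support fun P hP ↦
      (le_maximalIdeal P.2.ne_top).antisymm
        (hp.2 ⟨P.2, annihilator_le_of_mem_support hP⟩ (le_maximalIdeal P.2.ne_top))
    rw [h] at h0
    norm_cast at h0
  have := supportDim_quotSMulTop_succ_eq_of_notMem_minimalPrimes_of_mem_maximalIdeal hmin ha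
  rw [h, Nat.cast_add] at this
  exact ENat.WithBot.add_natCast_cancel.mp this

theorem IsPartSoP.mem_maximalIdeal {R M : Type*} [CommRing R] [IsLocalRing R] [AddCommGroup M]
    [Module R M] {x : R} (hx : IsPartSoP R M (fun _ : Fin 1 ↦ x)) : x ∈ maximalIdeal R := by
  obtain ⟨e, he, y, hy, hyx⟩ := hx
  have h : y (Fin.castLE he 0) = x := hyx 0
  rw [← h]
  exact hy.1 _

theorem IsPartSoP.supportDim_quotient_span_singleton {R M : Type*} [CommRing R] [IsLocalRing R]
    [IsNoetherianRing R] [AddCommGroup M] [Module R M] [Module.Finite R M] {d : ℕ}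
    (hd : supportDim R M = (d + 1 : ℕ)) {x : R} (hx : IsPartSoP R M (fun _ : Fin 1 ↦ x)) :
    supportDim R (M ⧸ Ideal.span {x} • (⊤ : Submodule R M)) = d := by
  classical
  have hxm := hx.mem_maximalIdeal
  obtain ⟨e, he, y, ⟨hym, hye, hyfin⟩, hyx⟩ := hx
  have hde : e = d + 1 := by
    have h : supportDim R M = (e : ℕ) := (moduleDim_eq_supportDim R M).symm.trans hye
    rw [hd] at h
    exact_mod_cast h.symm
  subst hde
  refine le_antisymm ?_ ?_
  · let s : Finset R := Finset.univ.image fun i : Fin d ↦ y i.succ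
    have hs : Ideal.span {x} ⊔ Ideal.span (s : Set R) = Ideal.span (Set.range y) := by
      rw [← Ideal.span_union, Finset.coe_image, Finset.coe_univ, Set.image_univ,
        Set.singleton_union, ← Fin.range_cons]
      congr 2
      funext i
      refine Fin.cases ?_ (fun j ↦ rfl) i
      exact (hyx 0).symm
    refine (supportDim_quotient_le_add_card (M := M) (Ideal.span {x}) s ?_).trans ?_
    · intro a ha
      obtain ⟨i, -, rfl⟩ := Finset.mem_image.mp ha
      exact hym _
    rw [hs]
    calc _ ≤ (0 : WithBot ℕ∞) + (d : WithBot ℕ∞) := by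
          gcongr
          · exact hyfin.supportDim_nonpos
          · exact Finset.card_image_le.trans (by simp)
      _ = d := zero_add _
  · have h := supportDim_quotient_le_add_card (M := M) ⊥ {x} (by simpa using hxm)
    rw [supportDim_quotient_bot_smul_top, hd, bot_sup_eq, Finset.coe_singleton,
      Finset.card_singleton, Nat.cast_add] at h
    exact ENat.WithBot.add_le_add_natCast_right_iff.mp h

theorem ringKrullDim_quotient_maximalIdeal {R : Type*} [CommRing R] [IsLocalRing R] :
    ringKrullDim (R ⧸ maximalIdeal R) = 0 :=
  ringKrullDim_eq_zero_of_field (ResidueField R)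

theorem isPartReducingSoP_of_notMem_associatedPrimes {R M : Type*} [CommRing R] [IsLocalRing R]
    [IsNoetherianRing R] [AddCommGroup M] [Module R M] [Module.Finite R M] {d : ℕ}
    (hd : supportDim R M = (d + 1 : ℕ)) {x : R} (hxm : x ∈ maximalIdeal R)
    (hx : supportDim R (M ⧸ Ideal.span {x} • (⊤ : Submodule R M)) = d)
    (hass : ∀ P ∈ associatedPrimes R M, ringKrullDim (R ⧸ P) = d → x ∉ P) :
    IsPartReducingSoP R M (fun _ : Fin 1 ↦ x) := by
  have step : ∀ I : Ideal R, ∃ a : R, ∀ n : ℕ,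
      supportDim R (M ⧸ I • (⊤ : Submodule R M)) = (n + 1 : ℕ) →
      a ∈ maximalIdeal R ∧ (∀ P ∈ associatedPrimes R (M ⧸ I • (⊤ : Submodule R M)),
        P ≠ maximalIdeal R → a ∉ P) ∧
      supportDim R (M ⧸ (I ⊔ Ideal.span {a}) • (⊤ : Submodule R M)) = n := by
    intro I
    by_cases hI : ∃ n : ℕ, supportDim R (M ⧸ I • (⊤ : Submodule R M)) = (n + 1 : ℕ)
    · obtain ⟨n, hn⟩ := hI
      obtain ⟨a, ha, haP, hdim⟩ := exists_notMem_associatedPrimes_supportDim_quotSMulTop hn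
      refine ⟨a, fun m hm ↦ ⟨ha, haP, ?_⟩⟩
      rw [hn] at hm
      rw [supportDim_quotient_sup_span_singleton, hdim]
      norm_cast at hm ⊢
      omega
    · exact ⟨0, fun n hn ↦ absurd ⟨n, hn⟩ hI⟩
  choose next hnext using step
  let g : ℕ → R × Ideal R := fun n ↦ Nat.rec (x, ⊥)
    (fun _ p ↦ (next (p.2 ⊔ Ideal.span {p.1}), p.2 ⊔ Ideal.span {p.1})) n
  have hg1 : ∀ n, (g (n + 1)).1 = next (g (n + 1)).2 := fun n ↦ rfl
  have hg2 : ∀ n, (g (n + 1)).2 = (g n).2 ⊔ Ideal.span {(g n).1} := fun n ↦ rfl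
  have hspan : ∀ n, (g n).2 = Ideal.span ((fun i ↦ (g i).1) '' {i | i < n}) := by
    intro n
    induction n with
    | zero => simp [g]
    | succ n ih =>
      rw [hg2, ih, ← Ideal.span_union]
      congr 1
      ext r
      simp only [Set.mem_union, Set.mem_image, Set.mem_ofPred_eq, Set.mem_singleton_iff,
        Nat.lt_succ_iff_lt_or_eq, or_and_right, exists_or, exists_eq_left]
      rw [eq_comm (a := r)]
  have hdim : ∀ n ≤ d, supportDim R (M ⧸ (g (n + 1)).2 • (⊤ : Submodule R M)) = (d - n : ℕ) := by
    intro n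
    induction n with
    | zero =>
      intro _
      rw [hg2, show (g 0).2 = ⊥ from rfl, bot_sup_eq]
      exact hx
    | succ n ih =>
      intro hn
      rw [hg2 (n + 1), hg1]
      refine ((hnext _ (d - (n + 1))) ?_).2.2
      rw [ih (by omega)]
      congr 1
      omega
  have hmem : ∀ n ≤ d, (g n).1 ∈ maximalIdeal R := by
    rintro (_ | n) hn
    · exact hxm
    · refine ((hnext _ (d - (n + 1))) ?_).1
      rw [hdim n (by omega)]
      congr 1
      omega
  refine ⟨d + 1, by omega, fun i ↦ (g i).1, ⟨⟨fun i ↦ hmem i (by omega), ?_, ?_⟩, ?_⟩, ?_⟩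
  · exact (moduleDim_eq_supportDim R M).trans hd
  · have hr : Set.range (fun i : Fin (d + 1) ↦ (g i).1) =
        (fun i ↦ (g i).1) '' {i | i < d + 1} := by
      ext r
      simp [Fin.exists_iff]
    rw [hr, ← hspan]
    refine isFiniteLength_of_supportDim_nonpos ?_
    rw [hdim d le_rfl]
    simp
  · intro i hi P hP hPd
    have hr : (fun i : Fin (d + 1) ↦ (g i).1) '' {j | (j : ℕ) < i} =
        (fun i ↦ (g i).1) '' {j | j < (i : ℕ)} := by
      ext r
      simp only [Set.mem_image, Set.mem_ofPred_eq]
      constructor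
      · rintro ⟨j, hj, rfl⟩
        exact ⟨j, hj, rfl⟩
      · rintro ⟨j, hj, rfl⟩
        exact ⟨⟨j, by omega⟩, hj, rfl⟩
    rw [hr, ← hspan] at hP
    obtain ⟨_ | n, hn⟩ := i
    · refine hass P ?_ hPd
      rwa [← LinearEquiv.AssociatedPrimes.eq
        (Submodule.quotEquivOfEqBot ((⊥ : Ideal R) • (⊤ : Submodule R M)) (by simp))]
    · simp only at hi hP hPd
      refine (hnext (g (n + 1)).2 (d - (n + 1)) ?_).2.1 P hP ?_
      · rw [hdim n (by omega)]
        congr 1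
        omega
      · rintro rfl
        rw [ringKrullDim_quotient_maximalIdeal] at hPd
        have h : ((0 : ℕ) : WithBot ℕ∞) = (d + 1 - (n + 1 + 1) : ℕ) := hPd
        have := Nat.cast_injective h
        omega
  · intro i
    obtain rfl : i = 0 := Subsingleton.elim _ _
    rfl

theorem IsPartReducingSoP.notMem_associatedPrimes {R M : Type*} [CommRing R] [IsLocalRing R]
    [AddCommGroup M] [Module R M] {d : ℕ} (hd : moduleDim R M = (d + 2 : ℕ)) {x : R}
    (hx : IsPartReducingSoP R M (fun _ : Fin 1 ↦ x)) {P : Ideal R}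
    (hP : P ∈ associatedPrimes R M) (hPd : ringKrullDim (R ⧸ P) = (d + 1 : ℕ)) : x ∉ P := by
  obtain ⟨e, he, y, ⟨hy, hyred⟩, hyx⟩ := hx
  obtain rfl : e = d + 2 := by
    have := hy.2.1
    rw [hd] at this
    exact_mod_cast this.symm
  have := hyred 0 (by simp) P ?_ hPd
  · rwa [← show y 0 = x from hyx 0]
  · rwa [LinearEquiv.AssociatedPrimes.eq (Submodule.quotEquivOfEqBot _ (by simp))]

theorem moduleDepth_le_supportDim {R M : Type*} [CommRing R] [IsLocalRing R] [IsNoetherianRing R]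
    [AddCommGroup M] [Module R M] [Module.Finite R M] [Nontrivial M] :
    moduleDepth R M ≤ supportDim R M := by
  refine sSup_le ?_
  rintro _ ⟨rs, rfl, -, hreg⟩
  rw [← supportDim_add_length_eq_supportDim_of_isRegular rs hreg]
  refine le_add_of_nonneg_left ?_
  have : Nontrivial (M ⧸ Ideal.ofList rs • (⊤ : Submodule R M)) :=
    Submodule.Quotient.nontrivial_iff.mpr hreg.top_ne_smul.symm
  exact Order.krullDim_nonneg_iff.mpr nonempty_support_of_nontrivial.to_subtype

theorem one_le_moduleDepth {R M : Type*} [CommRing R] [IsLocalRing R] [AddCommGroup M]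
    [Module R M] [Module.Finite R M] [Nontrivial M] {x : R} (hx : x ∈ maximalIdeal R)
    (hreg : IsSMulRegular M x) : 1 ≤ moduleDepth R M := by
  refine le_sSup ⟨[x], by simp, by simpa using hx, ?_⟩
  rw [IsLocalRing.isRegular_iff_isWeaklyRegular_of_subset_maximalIdeal (by simpa using hx)]
  exact (RingTheory.Sequence.isWeaklyRegular_singleton_iff M x).mpr hreg

theorem moduleDepth_nonpos_of_maximalIdeal_mem_associatedPrimes {R M : Type*} [CommRing R]
    [IsLocalRing R] [IsNoetherianRing R] [AddCommGroup M] [Module R M]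
    (h : maximalIdeal R ∈ associatedPrimes R M) : moduleDepth R M ≤ 0 := by
  refine sSup_le ?_
  rintro _ ⟨rs, rfl, hrs, hreg⟩
  obtain _ | ⟨a, rs⟩ := rs
  · simp
  · have ha : IsSMulRegular M a := ((RingTheory.Sequence.isRegular_cons_iff M a rs).mp hreg).1
    have hmem : a ∈ ⋃ p ∈ associatedPrimes R M, (p : Set R) :=
      Set.mem_biUnion h (hrs a (by simp))
    rw [biUnion_associatedPrimes_eq_compl_regular] at hmem
    exact absurd ha hmem

theorem isCMModule_localizedModule_of_notMem_associatedPrimes {R M : Type*} [CommRing R]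
    [IsNoetherianRing R] [AddCommGroup M] [Module R M] [Module.Finite R M] {x : R}
    {P : PrimeSpectrum R} (hP : P ∈ support R M) (hxP : x ∈ P.asIdeal)
    (hmin : ∀ Q ∈ support R M, x ∈ Q.asIdeal → Q ≤ P → Q = P)
    (hass : P.asIdeal ∉ associatedPrimes R M) :
    moduleDim (Localization.AtPrime P.asIdeal) (LocalizedModule P.asIdeal.primeCompl M) =
        (1 : ℕ) ∧
      IsCMModule (Localization.AtPrime P.asIdeal)
        (LocalizedModule P.asIdeal.primeCompl M) := by
  let A := Localization.AtPrime P.asIdeal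
  let N := LocalizedModule P.asIdeal.primeCompl M
  have : Nontrivial N := hP
  have hcomap : ∀ Q : Ideal A, Q.IsPrime → annihilator A N ≤ Q → algebraMap R A x ∈ Q →
      Q.comap (algebraMap R A) = P.asIdeal := by
    intro Q hQ hann hxQ
    have hmem : (⟨Q.comap (algebraMap R A), inferInstance⟩ : PrimeSpectrum R) ∈ support R M := by
      rw [mem_support_iff_of_finite]
      intro r hr
      refine hann (mem_annihilator.mpr fun n ↦ ?_)
      induction n using LocalizedModule.induction_on with
      | h m s =>
        rw [algebraMap_smul, LocalizedModule.smul'_mk, mem_annihilator.mp hr,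
          LocalizedModule.zero_mk]
    exact congrArg PrimeSpectrum.asIdeal (hmin _ hmem hxQ
      ((Ideal.comap_mono (le_maximalIdeal hQ.ne_top)).trans
        (IsLocalization.AtPrime.under_maximalIdeal A P.asIdeal).le))
  have hxm : algebraMap R A x ∈ maximalIdeal A :=
    (IsLocalization.AtPrime.to_map_mem_maximal_iff A P.asIdeal x).mpr hxP
  have hreg : IsSMulRegular N (algebraMap R A x) := by
    by_contra hcon
    have hmem : algebraMap R A x ∈ ⋃ p ∈ associatedPrimes A N, (p : Set A) := by
      rw [biUnion_associatedPrimes_eq_compl_regular]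
      exact hcon
    obtain ⟨Q, hQ, hxQ⟩ := Set.mem_iUnion₂.mp hmem
    have hQann : annihilator A N ≤ Q := by
      rw [← Submodule.annihilator_top]
      exact IsAssociatedPrime.annihilator_le hQ
    have h := hQ
    rw [← associatedPrimes.preimage_comap_associatedPrimes_eq_associatedPrimes_of_isLocalizedModule
      P.asIdeal.primeCompl A (LocalizedModule.mkLinearMap P.asIdeal.primeCompl M),
      Set.mem_preimage, hcomap Q (IsAssociatedPrime.isPrime hQ) hQann hxQ] at h
    exact hass h
  have hquot : supportDim A (QuotSMulTop (algebraMap R A x) N) = 0 := by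
    refine le_antisymm (supportDim_nonpos_of_forall_mem_support fun Q hQ ↦ ?_) ?_
    · rw [support_quotSMulTop] at hQ
      have h := hcomap Q.asIdeal Q.2 (annihilator_le_of_mem_support hQ.1) (by simpa using hQ.2)
      have := IsLocalization.AtPrime.under_maximalIdeal A P.asIdeal
      have hQ' : Q.asIdeal.under R = (maximalIdeal A).under R := h.trans this.symm
      rw [← IsLocalization.map_under P.asIdeal.primeCompl A Q.asIdeal, hQ',
        IsLocalization.map_under P.asIdeal.primeCompl A]
    · have h := supportDim_le_supportDim_quotSMulTop_succ (M := N) hxm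
      have : Nontrivial (QuotSMulTop (algebraMap R A x) N) := by
        by_contra hcon
        rw [not_nontrivial_iff_subsingleton] at hcon
        rw [supportDim_eq_bot_of_subsingleton A (QuotSMulTop (algebraMap R A x) N),
          WithBot.bot_add, le_bot_iff] at h
        exact supportDim_ne_bot_of_nontrivial A N h
      exact Order.krullDim_nonneg_iff.mpr nonempty_support_of_nontrivial.to_subtype
  have hdim : supportDim A N = 1 := by
    rw [← supportDim_quotSMulTop_succ_eq_supportDim hreg hxm, hquot, zero_add]
  refine ⟨(moduleDim_eq_supportDim A N).trans hdim, ?_⟩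
  refine ((moduleDepth_le_supportDim (R := A) (M := N)).antisymm ?_).trans
    (moduleDim_eq_supportDim A N).symm
  rw [hdim]
  exact one_le_moduleDepth hxm hreg

theorem not_isCMModule_localizedModule_of_mem_associatedPrimes {R M : Type*} [CommRing R]
    [IsNoetherianRing R] [AddCommGroup M] [Module R M] {P : Ideal R} [P.IsPrime]
    (hP : P ∈ associatedPrimes R M)
    (hdim : moduleDim (Localization.AtPrime P) (LocalizedModule P.primeCompl M) = (1 : ℕ)) :
    ¬ IsCMModule (Localization.AtPrime P) (LocalizedModule P.primeCompl M) := by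
  intro h
  have h0 := moduleDepth_nonpos_of_maximalIdeal_mem_associatedPrimes
    (associatedPrimes.mem_associatedPrimes_atPrime_of_mem_associatedPrimes hP)
  rw [h.trans hdim] at h0
  norm_cast at h0

theorem mem_support_of_mem_associatedPrimes {R M : Type*} [CommRing R] [IsNoetherianRing R]
    [AddCommGroup M] [Module R M] [Module.Finite R M] {P : PrimeSpectrum R}
    (hP : P.asIdeal ∈ associatedPrimes R M) : P ∈ support R M := by
  rw [mem_support_iff_of_finite, ← Submodule.annihilator_top]
  exact IsAssociatedPrime.annihilator_le hP

theorem stmt10 (R M : Type*) [CommRing R] [IsLocalRing R] [IsNoetherianRing R]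
    [AddCommGroup M] [Module R M] [Module.Finite R M] [Nontrivial M]
    {d : ℕ} (hd : moduleDim R M = (d : ℕ)) (hd2 : 2 ≤ d) (x : R)
    (hx : IsPartSoP R M (fun _ : Fin 1 => x)) :
    IsPartReducingSoP R M (fun _ : Fin 1 => x) ↔
      ∀ P : PrimeSpectrum R, P ∈ Module.support R M → x ∈ P.asIdeal →
        ringKrullDim (R ⧸ P.asIdeal) = ((d - 1 : ℕ) : WithBot (WithTop ℕ)) →
        moduleDim (Localization.AtPrime P.asIdeal) (LocalizedModule P.asIdeal.primeCompl M)
            = (1 : ℕ) ∧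
          IsCMModule (Localization.AtPrime P.asIdeal)
            (LocalizedModule P.asIdeal.primeCompl M) := by
  obtain ⟨d, rfl⟩ := Nat.exists_eq_add_of_le' hd2
  have hd' : supportDim R M = (d + 1 + 1 : ℕ) := (moduleDim_eq_supportDim R M).symm.trans hd
  have hquot := hx.supportDim_quotient_span_singleton hd'
  constructor
  · intro hred P hP hxP hPd
    refine isCMModule_localizedModule_of_notMem_associatedPrimes hP hxP (fun Q hQ hxQ hQP ↦ ?_)
      fun hass ↦ hred.notMem_associatedPrimes hd hass hPd hxP
    refine PrimeSpectrum.ext (eq_of_le_of_ringKrullDim_quotient_le hQP hPd ?_)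
    refine le_trans (b := supportDim R (M ⧸ Ideal.span {x} • (⊤ : Submodule R M))) ?_ hquot.le
    refine ringKrullDim_quotient_le_supportDim ?_
    rw [support_quotient, PrimeSpectrum.zeroLocus_span]
    exact ⟨hQ, by simpa using hxQ⟩
  · intro h
    refine isPartReducingSoP_of_notMem_associatedPrimes hd' hx.mem_maximalIdeal hquot
      fun P hP hPd hxP ↦ ?_
    have hprime : P.IsPrime := IsAssociatedPrime.isPrime hP
    obtain ⟨hdim, hCM⟩ := h ⟨P, hprime⟩ (mem_support_of_mem_associatedPrimes hP) hxP hPd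
    exact not_isCMModule_localizedModule_of_mem_associatedPrimes hP hdim hCM
end

section
/- Every regular sequence on M consisting of elements of 𝔪 is part of a reducing system of parameters of M. -/
open IsLocalRing

section

variable {R M : Type*} [CommRing R] [AddCommGroup M] [Module R M]

open Pointwise in
/-- Adding one more generator to an ideal `span S` does to `M ⧸ span S • ⊤` the same as
factoring out that generator. -/
lemma supportDim_quotient_span_insert_smul_top (a : R) (S : Set R) :
    Module.supportDim R (M ⧸ (Ideal.span (insert a S) • (⊤ : Submodule R M))) =
      Module.supportDim R (QuotSMulTop a (M ⧸ (Ideal.span S • (⊤ : Submodule R M)))) := by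
  refine Module.supportDim_eq_of_equiv ?_
  refine Submodule.quotEquivOfEq _ (Ideal.span S • ⊤ ⊔ a • ⊤) ?_ ≪≫ₗ
    (Submodule.quotientQuotientEquivQuotientSup (Ideal.span S • ⊤) (a • ⊤)).symm ≪≫ₗ
    Submodule.quotEquivOfEq _ _ ?_
  · rw [Ideal.span_insert, Submodule.sup_smul, sup_comm, Submodule.ideal_span_singleton_smul]
  · rw [Submodule.map_pointwise_smul, Submodule.map_top, Submodule.range_mkQ]

/-- A finitely generated module of dimension zero over a Noetherian ring has finite length. -/
lemma isFiniteLength_of_supportDim_eq_zero [IsNoetherianRing R] [Module.Finite R M]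
    (h : Module.supportDim R M = 0) : IsFiniteLength R M := by
  rw [isFiniteLength_iff_isNoetherian_isArtinian]
  refine ⟨inferInstance, ?_⟩
  rw [Module.supportDim_eq_ringKrullDim_quotient_annihilator] at h
  have : IsArtinianRing (R ⧸ Module.annihilator R M) := by
    rw [isArtinianRing_iff_krullDimLE_zero, Ring.KrullDimLE, Order.krullDimLE_iff]
    exact h.le
  let _ : Module (R ⧸ Module.annihilator R M) M := Module.quotientAnnihilator
  have : Module.Finite (R ⧸ Module.annihilator R M) M :=
    Module.Finite.of_restrictScalars_finite R _ _
  have : IsArtinian (R ⧸ Module.annihilator R M) M := isArtinian_of_fg_of_artinian'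
  exact isArtinian_of_surjective_algebraMap
    (Ideal.Quotient.mk_surjective (I := Module.annihilator R M))

variable [IsLocalRing R]

/-- In positive dimension the maximal ideal is not minimal over the annihilator. -/
lemma maximalIdeal_notMem_minimalPrimes_annihilator [Module.Finite R M]
    (h : 0 < Module.supportDim R M) :
    maximalIdeal R ∉ (Module.annihilator R M).minimalPrimes := by
  intro hm
  refine h.not_ge ?_
  have key : ∀ p : Module.support R M, p.1.1 = maximalIdeal R := fun p ↦ by
    have hle := le_maximalIdeal p.1.2.ne_top
    exact le_antisymm hle (hm.2 ⟨p.1.2, Module.mem_support_iff_of_finite.1 p.2⟩ hle)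
  have : Subsingleton (Module.support R M) :=
    ⟨fun p q ↦ Subtype.ext (PrimeSpectrum.ext ((key p).trans (key q).symm))⟩
  exact Order.krullDim_nonpos_of_subsingleton

/-- Prime avoidance: some element of the maximal ideal lies in no non-maximal associated prime. -/
lemma exists_mem_maximalIdeal_notMem_associatedPrimes (R M : Type*) [CommRing R] [IsLocalRing R]
    [IsNoetherianRing R] [AddCommGroup M] [Module R M] [Module.Finite R M] :
    ∃ a ∈ maximalIdeal R, ∀ P ∈ associatedPrimes R M, P ≠ maximalIdeal R → a ∉ P := by
  by_contra! hcon
  have hsub : (maximalIdeal R : Set R) ⊆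
      ⋃ P ∈ {P ∈ associatedPrimes R M | P ≠ maximalIdeal R}, ((id P : Ideal R) : Set R) := by
    intro a ha
    obtain ⟨P, hP, hne, haP⟩ := hcon a ha
    exact Set.mem_biUnion (show P ∈ {P ∈ associatedPrimes R M | P ≠ maximalIdeal R} from
      ⟨hP, hne⟩) haP
  obtain ⟨P, ⟨hP, hne⟩, hle⟩ := (Ideal.subset_union_prime_finite
    ((associatedPrimes.finite R M).subset (Set.sep_subset _ _)) (f := id) 0 0
    (fun P hP _ _ ↦ hP.1.isPrime)).1 hsub
  exact hne (le_antisymm (le_maximalIdeal hP.isPrime.ne_top) hle)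

variable (M) in
/-- The first `n` terms of `y` lie in the maximal ideal, and each of them avoids the non-maximal
associated primes of the quotient of `M` by the preceding terms. -/
def AvoidsAssociatedPrimes (y : ℕ → R) (n : ℕ) : Prop :=
  ∀ j < n, y j ∈ maximalIdeal R ∧
    ∀ P ∈ associatedPrimes R (M ⧸ (Ideal.span (y '' Set.Iio j) • (⊤ : Submodule R M))),
      P ≠ maximalIdeal R → y j ∉ P

lemma AvoidsAssociatedPrimes.exists_extend [IsNoetherianRing R] [Module.Finite R M] {y : ℕ → R}
    {r : ℕ} (hy : AvoidsAssociatedPrimes M y r) {n : ℕ} (hrn : r ≤ n) :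
    ∃ z : ℕ → R, (∀ j < r, z j = y j) ∧ AvoidsAssociatedPrimes M z n := by
  induction n, hrn using Nat.le_induction with
  | base => exact ⟨y, fun _ _ ↦ rfl, hy⟩
  | succ n hrn ih =>
    obtain ⟨z, hzy, hz⟩ := ih
    obtain ⟨a, ha, haP⟩ := exists_mem_maximalIdeal_notMem_associatedPrimes R
      (M ⧸ (Ideal.span (z '' Set.Iio n) • (⊤ : Submodule R M)))
    have himage : ∀ j ≤ n, Function.update z n a '' Set.Iio j = z '' Set.Iio j := fun j hj ↦
      Set.image_congr fun i hi ↦ Function.update_of_ne (lt_of_lt_of_le hi hj).ne _ _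
    refine ⟨Function.update z n a, fun j hj ↦ ?_, fun j hj ↦ ?_⟩
    · rw [Function.update_of_ne (by omega), hzy j hj]
    · rw [himage j (by omega)]
      obtain hj | rfl := Nat.lt_succ_iff_lt_or_eq.1 hj
      · rw [Function.update_of_ne hj.ne]
        exact hz j hj
      · rw [Function.update_self]
        exact ⟨ha, haP⟩

lemma AvoidsAssociatedPrimes.supportDim_add [IsNoetherianRing R] [Module.Finite R M] {y : ℕ → R}
    {d : ℕ} (hd : Module.supportDim R M = d) (hy : AvoidsAssociatedPrimes M y d)
    {n : ℕ} (hn : n ≤ d) :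
    Module.supportDim R (M ⧸ (Ideal.span (y '' Set.Iio n) • (⊤ : Submodule R M))) =
      ((d - n : ℕ) : WithBot ℕ∞) := by
  induction n with
  | zero =>
    have : Ideal.span (y '' Set.Iio 0) • (⊤ : Submodule R M) = ⊥ := by simp
    rw [Module.supportDim_eq_of_equiv (Submodule.quotEquivOfEqBot _ this), hd, Nat.sub_zero]
  | succ n ih =>
    specialize ih (by omega)
    have himage : y '' Set.Iio (n + 1) = insert (y n) (y '' Set.Iio n) := by
      rw [← Set.image_insert_eq]
      congr 1
      ext
      simp only [Set.mem_Iio, Set.mem_insert_iff]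
      omega
    have hpos : 0 < Module.supportDim R
        (M ⧸ (Ideal.span (y '' Set.Iio n) • (⊤ : Submodule R M))) := by
      rw [ih]
      exact_mod_cast (by omega : 0 < d - n)
    have hstep := Module.supportDim_quotSMulTop_succ_eq_of_notMem_minimalPrimes_of_mem_maximalIdeal
      (M := M ⧸ (Ideal.span (y '' Set.Iio n) • (⊤ : Submodule R M))) (x := y n)
      (fun p hp ↦ (hy n (by omega)).2 p
        (Module.associatedPrimes.minimalPrimes_annihilator_subset_associatedPrimes _ _ hp)
        fun h ↦ maximalIdeal_notMem_minimalPrimes_annihilator hpos (h ▸ hp)) (hy n (by omega)).1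
    rw [ih, ← supportDim_quotient_span_insert_smul_top, ← himage,
      show d - n = d - (n + 1) + 1 by omega, Nat.cast_add, Nat.cast_one] at hstep
    exact ENat.WithBot.add_one_cancel.1 hstep

lemma avoidsAssociatedPrimes_of_isWeaklyRegular [IsNoetherianRing R] {r : ℕ} {x : Fin r → R}
    {y : ℕ → R} (hyx : ∀ i : Fin r, y i = x i) (hx : ∀ i, x i ∈ maximalIdeal R)
    (hreg : RingTheory.Sequence.IsWeaklyRegular M (List.ofFn x)) :
    AvoidsAssociatedPrimes M y r := by
  intro j hj
  have hyj : y j = x ⟨j, hj⟩ := hyx ⟨j, hj⟩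
  refine ⟨hyj ▸ hx _, fun P hP _ hmem ↦ ?_⟩
  have h := hreg.regular_mod_prev j (by simpa using hj)
  have hspan : Ideal.ofList ((List.ofFn x).take j) = Ideal.span (y '' Set.Iio j) := by
    rw [Ideal.ofList]
    congr 1
    ext a
    simp only [Set.mem_ofPred_eq, List.mem_take_iff_getElem, List.length_ofFn, List.getElem_ofFn,
      Set.mem_image, Set.mem_Iio]
    constructor
    · rintro ⟨i, hi, rfl⟩
      exact ⟨i, by omega, hyx ⟨i, by omega⟩⟩
    · rintro ⟨i, hi, rfl⟩
      exact ⟨i, by omega, (hyx ⟨i, by omega⟩).symm⟩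
  rw [hspan, List.getElem_ofFn, ← hyj] at h
  have hmem' := Set.mem_biUnion (t := fun P : Ideal R ↦ (P : Set R)) hP hmem
  rw [biUnion_associatedPrimes_eq_compl_regular R] at hmem'
  exact hmem' h

end

theorem stmt13 (R M : Type*) [CommRing R] [IsLocalRing R] [IsNoetherianRing R]
    [AddCommGroup M] [Module R M] [Module.Finite R M] [Nontrivial M]
    {r : ℕ} (x : Fin r → R) (hx : ∀ i, x i ∈ maximalIdeal R)
    (hreg : RingTheory.Sequence.IsRegular M (List.ofFn x)) :
    IsPartReducingSoP R M x := by
  have hfin : Module.supportDim R M < ⊤ :=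
    (Module.supportDim_le_ringKrullDim R M).trans_lt ringKrullDim_lt_top
  obtain ⟨d, hd⟩ : ∃ d : ℕ, Module.supportDim R M = d := by
    obtain ⟨e, he⟩ := WithBot.ne_bot_iff_exists.1 (Module.supportDim_ne_bot_of_nontrivial R M)
    rw [← he] at hfin ⊢
    obtain ⟨d, hd⟩ := ENat.ne_top_iff_exists.1 (WithBot.coe_lt_coe.1 hfin).ne
    exact ⟨d, by rw [← hd]; rfl⟩
  have hrd : r ≤ d := by
    have h := Module.supportDim_add_length_eq_supportDim_of_isRegular _ hreg
    have hnt := hreg.quot_ofList_smul_nontrivial (⊤ : Submodule R M)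
    obtain ⟨e, he⟩ := WithBot.ne_bot_iff_exists.1 (Module.supportDim_ne_bot_of_nontrivial R
      (M ⧸ (Ideal.ofList (List.ofFn x) • (⊤ : Submodule R M))))
    rw [← he, hd, List.length_ofFn] at h
    have h' : e + (r : ℕ∞) = d := by exact_mod_cast h
    exact_mod_cast h' ▸ le_add_self
  obtain ⟨y, hyx, hy⟩ := (avoidsAssociatedPrimes_of_isWeaklyRegular (M := M)
    (y := fun n ↦ if h : n < r then x ⟨n, h⟩ else 0) (fun i ↦ by simp) hx
    hreg.toIsWeaklyRegular).exists_extend hrd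
  refine ⟨d, hrd, fun i ↦ y i, ⟨⟨fun i ↦ (hy i i.2).1, ?_, ?_⟩, fun i hi P hP hdim ↦ ?_⟩,
    fun i ↦ ?_⟩
  · exact (Module.supportDim_eq_ringKrullDim_quotient_annihilator R M).symm.trans hd
  · have hrange : Set.range (fun i : Fin d ↦ y i) = y '' Set.Iio d := by
      ext a
      simp [Fin.exists_iff]
    rw [hrange]
    exact isFiniteLength_of_supportDim_eq_zero (by simpa using hy.supportDim_add hd le_rfl)
  · have himage : (fun i : Fin d ↦ y i) '' {j : Fin d | (j : ℕ) < (i : ℕ)} =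
        y '' Set.Iio (i : ℕ) := by
      ext a
      constructor
      · rintro ⟨j, hj, rfl⟩
        exact ⟨j, hj, rfl⟩
      · rintro ⟨j, hj, rfl⟩
        exact ⟨⟨j, lt_trans hj i.2⟩, hj, rfl⟩
    rw [himage] at hP
    refine (hy i i.2).2 P hP fun hPm ↦ ?_
    subst hPm
    rw [ringKrullDim_eq_zero_of_isField
      ((Ideal.Quotient.maximal_ideal_iff_isField_quotient _).1 inferInstance)] at hdim
    have hcast : ((0 : ℕ) : WithBot ℕ∞) = ((d - ((i : ℕ) + 1) : ℕ) : WithBot ℕ∞) := hdim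
    have : 0 = d - ((i : ℕ) + 1) := by exact_mod_cast hcast
    omega
  · simp [hyx i i.2]
end

section
/- Assume M is a Cohen–Macaulay R-module and let (x_1,…,x_r) be part of a system of parameters of M. Then M/(x_1,…,x_r)M is unmixed: dim R/P = dim_R M − r for every associated prime P of M/(x_1,…,x_r)M. -/
open IsLocalRing

open CategoryTheory Abelian Limits RingTheory.Sequence Pointwise in
/-- If there is a regular sequence of length `n + 1` on `M` in a proper ideal `I` then, for every
`M`-regular `x ∈ I`, there is one of length `n` on `M ⧸ xM` in `I`. -/
lemma exists_isRegular_quotSMulTop_of_small.{u, v} {R : Type u} [CommRing R] [IsNoetherianRing R]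
    [Small.{v} R] (I : Ideal R) {M : Type v} [AddCommGroup M] [Module R M] [Module.Finite R M]
    {x : R} (hx : IsSMulRegular M x)
    (hI : I • (⊤ : Submodule R M) < ⊤)
    (hI' : I • (⊤ : Submodule R (QuotSMulTop x M)) < ⊤) {n : ℕ}
    (h : ∃ rs : List R, rs.length = n + 1 ∧ (∀ r ∈ rs, r ∈ I) ∧ IsRegular M rs) :
    ∃ rs : List R, rs.length = n ∧ (∀ r ∈ rs, r ∈ I) ∧ IsRegular (QuotSMulTop x M) rs := by
  have hext := ((ModuleCat.exists_isRegular_tfae I (n + 1) (ModuleCat.of R M) hI).out 3 1).mp h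
  refine ((ModuleCat.exists_isRegular_tfae I n (ModuleCat.of R (QuotSMulTop x M)) hI').out
    1 3).mp fun i hi ↦ ?_
  have zero1 := AddCommGrpCat.isZero_of_iff_subsingleton.mpr (hext i (by omega))
  have zero2 := AddCommGrpCat.isZero_of_iff_subsingleton.mpr (hext (i + 1) (by omega))
  have hx' : IsSMulRegular (ModuleCat.of R M) x := hx
  exact AddCommGrpCat.subsingleton_of_isZero <| ShortComplex.Exact.isZero_of_both_zeros
    ((Ext.covariant_sequence_exact₃' _ hx'.smulShortComplex_shortExact) i (i + 1) rfl)
    (zero1.eq_zero_of_src _) (zero2.eq_zero_of_tgt _)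

section

open IsLocalRing RingTheory.Sequence Pointwise

lemma ringKrullDim_quotient_succ_le_of_lt {R : Type*} [CommRing R] {P Q : Ideal R} [P.IsPrime]
    (h : P < Q) : ringKrullDim (R ⧸ Q) + 1 ≤ ringKrullDim (R ⧸ P) := by
  obtain ⟨x, hxQ, hxP⟩ := SetLike.exists_of_lt h
  refine ringKrullDim_succ_le_of_surjective (Ideal.Quotient.factor h.le)
    (Ideal.Quotient.factor_surjective h.le) (r := Ideal.Quotient.mk P x) ?_ ?_
  · rw [mem_nonZeroDivisors_iff_ne_zero, Ne, Ideal.Quotient.eq_zero_iff_mem]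
    exact hxP
  · rw [Ideal.Quotient.factor_mk, Ideal.Quotient.eq_zero_iff_mem]
    exact hxQ

variable {R M : Type*} [CommRing R] [IsLocalRing R] [IsNoetherianRing R]
    [AddCommGroup M] [Module R M] [Module.Finite R M]

omit [IsNoetherianRing R] in
lemma maximalIdeal_smul_top_lt_top [Nontrivial M] :
    maximalIdeal R • (⊤ : Submodule R M) < ⊤ :=
  lt_top_iff_ne_top.mpr (Submodule.top_ne_ideal_smul_of_le_jacobson_annihilator
    (maximalIdeal_le_jacobson _)).symm

lemma exists_isRegular_quotSMulTop.{u, v} {R : Type u} {M : Type v} [CommRing R] [IsLocalRing R]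
    [IsNoetherianRing R] [AddCommGroup M] [Module R M] [Module.Finite R M] [Nontrivial M] {x : R} (hx : IsSMulRegular M x)
    (hxm : x ∈ maximalIdeal R) {n : ℕ}
    (h : ∃ rs : List R, rs.length = n + 1 ∧ (∀ r ∈ rs, r ∈ maximalIdeal R) ∧ IsRegular M rs) :
    ∃ rs : List R, rs.length = n ∧ (∀ r ∈ rs, r ∈ maximalIdeal R) ∧
      IsRegular (QuotSMulTop x M) rs := by
  let e : ULift.{u} M ≃ₗ[R] M := ULift.moduleEquiv
  have := nontrivial_quotSMulTop_of_mem_maximalIdeal (ULift.{u} M) hxm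
  have hx' : IsSMulRegular (ULift.{u} M) x := (e.isSMulRegular_congr x).mpr hx
  obtain ⟨rs, hl, hm, hr⟩ := exists_isRegular_quotSMulTop_of_small (maximalIdeal R) hx'
    maximalIdeal_smul_top_lt_top maximalIdeal_smul_top_lt_top
    (h.imp fun rs ⟨hl, hm, hr⟩ ↦ ⟨hl, hm, (e.isRegular_congr rs).mpr hr⟩)
  exact ⟨rs, hl, hm, ((QuotSMulTop.congr x e).isRegular_congr rs).mp hr⟩

/-- An associated prime of `M` together with an `M`-regular element `x` lies in some associated
prime of `M ⧸ xM`. -/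
lemma exists_mem_associatedPrimes_quotSMulTop {x : R} (hx : IsSMulRegular M x)
    (hxm : x ∈ maximalIdeal R) {P : Ideal R} (hP : P ∈ associatedPrimes R M) :
    ∃ Q ∈ associatedPrimes R (QuotSMulTop x M), P ≤ Q ∧ x ∈ Q := by
  obtain ⟨hPp, m, hm⟩ := isAssociatedPrime_iff.mp hP
  let N : Submodule R M := Submodule.torsionBySet R M P
  have hmN : m ∈ N := by
    rw [Submodule.mem_torsionBySet_iff]
    rintro ⟨a, ha⟩
    rw [SetLike.mem_coe, hm, Submodule.mem_colon_singleton] at ha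
    exact ha
  have hm0 : m ≠ 0 := by
    rintro rfl
    apply hPp.ne_top
    simp [hm]
  have hN : ∃ n ∈ N, n ∉ x • (⊤ : Submodule R M) := by
    by_contra! hc
    refine hm0 ?_
    have hbot : N = ⊥ := by
      refine Submodule.eq_bot_of_le_smul_of_le_jacobson_bot (Ideal.span {x}) N
        (IsNoetherian.noetherian N) ?_ ?_
      · intro n hn
        obtain ⟨k, -, rfl⟩ := (Submodule.mem_smul_pointwise_iff_exists _ _ _).mp (hc n hn)
        refine Submodule.smul_mem_smul (Ideal.mem_span_singleton_self x) ?_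
        rw [Submodule.mem_torsionBySet_iff] at hn ⊢
        intro a
        refine hx ?_
        simpa [smul_comm x] using hn a
      · rw [Ideal.span_singleton_le_iff_mem]
        exact maximalIdeal_le_jacobson _ hxm
    simpa [hbot] using hmN
  obtain ⟨n, hnN, hn⟩ := hN
  obtain ⟨Q, hQ, hle⟩ := exists_le_isAssociatedPrime_of_isNoetherianRing R
    (Submodule.Quotient.mk n : QuotSMulTop x M) (by rwa [Ne, Submodule.Quotient.mk_eq_zero])
  refine ⟨Q, hQ, fun a ha ↦ hle ?_, hle ?_⟩
  · rw [Submodule.mem_colon_singleton, Submodule.mem_bot, ← Submodule.Quotient.mk_smul,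
      (Submodule.mem_torsionBySet_iff _ _).mp hnN ⟨a, ha⟩, Submodule.Quotient.mk_zero]
  · rw [Submodule.mem_colon_singleton, Submodule.mem_bot, ← Submodule.Quotient.mk_smul,
      Submodule.Quotient.mk_eq_zero]
    exact Submodule.smul_mem_pointwise_smul _ _ _ trivial

omit [IsLocalRing R] [Module.Finite R M] in
lemma IsSMulRegular.notMem_of_mem_associatedPrimes {x : R} (hx : IsSMulRegular M x) {P : Ideal R}
    (hP : P ∈ associatedPrimes R M) : x ∉ P := by
  obtain ⟨hPp, m, hm⟩ := isAssociatedPrime_iff.mp hP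
  intro hxP
  rw [hm, Submodule.mem_colon_singleton, Submodule.mem_bot] at hxP
  apply hPp.ne_top
  simp [hm, hx.right_eq_zero_of_smul hxP]

/-- The length of a regular sequence on `M` is at most `dim R ⧸ P` for all `P ∈ Ass M`. -/
lemma length_le_ringKrullDim_quotient_of_isRegular (rs : List R)
    (hm : ∀ r ∈ rs, r ∈ maximalIdeal R) (hrs : IsRegular M rs) {P : Ideal R}
    (hP : P ∈ associatedPrimes R M) : (rs.length : WithBot ℕ∞) ≤ ringKrullDim (R ⧸ P) := by
  induction rs generalizing M P with
  | nil =>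
    have := hP.isPrime
    exact ringKrullDim_nonneg_of_nontrivial
  | cons x rs ih =>
    have := hP.isPrime
    obtain ⟨hx, hrs⟩ := (isRegular_cons_iff M _ _).mp hrs
    obtain ⟨Q, hQ, hPQ, hxQ⟩ := exists_mem_associatedPrimes_quotSMulTop hx (hm x (by simp)) hP
    have hlt : P < Q := hPQ.lt_of_not_ge fun h ↦ hx.notMem_of_mem_associatedPrimes hP (h hxQ)
    have h1 := ih (fun r hr ↦ hm r (by simp [hr])) hrs hQ
    rw [List.length_cons, Nat.cast_succ]
    exact (by gcongr : _ ≤ _).trans (ringKrullDim_quotient_succ_le_of_lt hlt)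

omit [IsLocalRing R] [IsNoetherianRing R] in
lemma ringKrullDim_quotient_le_supportDim_s14 {P : Ideal R} (hP : Module.annihilator R M ≤ P) :
    ringKrullDim (R ⧸ P) ≤ Module.supportDim R M := by
  rw [Module.supportDim_eq_ringKrullDim_quotient_annihilator]
  exact ringKrullDim_le_of_surjective (Ideal.Quotient.factor hP)
    (Ideal.Quotient.factor_surjective hP)

omit [IsLocalRing R] [IsNoetherianRing R] [Module.Finite R M] in
lemma annihilator_le_of_mem_associatedPrimes {P : Ideal R} (hP : P ∈ associatedPrimes R M) :
    Module.annihilator R M ≤ P := by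
  simpa [Submodule.annihilator_top] using hP.annihilator_le

lemma supportDim_le_supportDim_quotient_add_length (l : List R)
    (hl : ∀ r ∈ l, r ∈ maximalIdeal R) :
    Module.supportDim R M ≤
      Module.supportDim R (M ⧸ Ideal.ofList l • (⊤ : Submodule R M)) + l.length := by
  induction l generalizing M with
  | nil =>
    have e : (M ⧸ Ideal.ofList ([] : List R) • (⊤ : Submodule R M)) ≃ₗ[R] M :=
      Submodule.quotEquivOfEqBot _ (by simp)
    simp [Module.supportDim_eq_of_equiv e]
  | cons x l ih =>
    have h1 := Module.supportDim_le_supportDim_quotSMulTop_succ (M := M) (hl x (by simp))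
    have h2 := ih (M := QuotSMulTop x M) fun r hr ↦ hl r (by simp [hr])
    rw [Module.supportDim_eq_of_equiv
      (Submodule.quotOfListConsSMulTopEquivQuotSMulTopInner M x l), List.length_cons,
      Nat.cast_succ, ← add_assoc]
    exact h1.trans (by gcongr)

lemma supportDim_nonpos_of_isFiniteLength (h : IsFiniteLength R M) :
    Module.supportDim R M ≤ 0 := by
  obtain ⟨-, _⟩ := isFiniteLength_iff_isNoetherian_isArtinian.mp h
  have key : ∀ p ∈ Module.support R M, p = closedPoint R := by
    intro p hp
    obtain ⟨q, hq, hqp⟩ := Ideal.exists_minimalPrimes_le (Module.mem_support_iff_of_finite.mp hp)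
    obtain ⟨hqp', f, hf⟩ := (isAssociatedPrime_iff_exists_injective_linearMap q M).mp
      (Module.associatedPrimes.minimalPrimes_annihilator_subset_associatedPrimes R M hq)
    have : IsArtinian R (R ⧸ q) := isArtinian_of_injective f hf
    have : IsArtinianRing (R ⧸ q) := isArtinian_of_tower R this
    have hmax : q.IsMaximal := Ideal.Quotient.maximal_of_isField _
      (IsArtinianRing.isField_of_isDomain _)
    have : p.asIdeal = maximalIdeal R := by
      rw [← eq_maximalIdeal hmax]
      exact (hmax.eq_of_le p.2.ne_top hqp).symm
    exact PrimeSpectrum.ext this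
  have : Subsingleton (Module.support R M) :=
    ⟨fun a b ↦ Subtype.ext ((key a a.2).trans (key b b.2).symm)⟩
  exact Order.krullDim_nonpos_of_subsingleton

/-- If `M` carries a regular sequence of length `n = dim M`, then `M` is unmixed. -/
lemma ringKrullDim_quotient_eq_of_mem_associatedPrimes {n : ℕ}
    (hdim : Module.supportDim R M = n)
    (hreg : ∃ rs : List R, rs.length = n ∧ (∀ r ∈ rs, r ∈ maximalIdeal R) ∧ IsRegular M rs)
    {P : Ideal R} (hP : P ∈ associatedPrimes R M) : ringKrullDim (R ⧸ P) = n := by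
  obtain ⟨rs, hlen, hm, hrs⟩ := hreg
  refine le_antisymm ?_ ?_
  · rw [← hdim]
    exact ringKrullDim_quotient_le_supportDim_s14 (annihilator_le_of_mem_associatedPrimes hP)
  · rw [← hlen]
    exact length_le_ringKrullDim_quotient_of_isRegular rs hm hrs hP

/-- If `M` carries a regular sequence of length `n = dim M` and killing `l` lowers the dimension
by at least the length of `l`, then `M ⧸ (l)M` is unmixed of dimension `n - l.length`. -/
theorem ringKrullDim_quotient_add_length_of_mem_associatedPrimes (l : List R)
    (hl : ∀ r ∈ l, r ∈ maximalIdeal R) [Nontrivial M] {n : ℕ}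
    (hdim : Module.supportDim R M = n)
    (hreg : ∃ rs : List R, rs.length = n ∧ (∀ r ∈ rs, r ∈ maximalIdeal R) ∧ IsRegular M rs)
    (hdrop : Module.supportDim R (M ⧸ Ideal.ofList l • (⊤ : Submodule R M)) + l.length ≤ n)
    {P : Ideal R} (hP : P ∈ associatedPrimes R (M ⧸ Ideal.ofList l • (⊤ : Submodule R M))) :
    ringKrullDim (R ⧸ P) + l.length = n := by
  induction l generalizing M n P with
  | nil =>
    have e : (M ⧸ Ideal.ofList ([] : List R) • (⊤ : Submodule R M)) ≃ₗ[R] M :=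
      Submodule.quotEquivOfEqBot _ (by simp)
    rw [LinearEquiv.AssociatedPrimes.eq e] at hP
    simpa using ringKrullDim_quotient_eq_of_mem_associatedPrimes hdim hreg hP
  | cons x l ih =>
    have hxm : x ∈ maximalIdeal R := hl x (by simp)
    have hlm : ∀ r ∈ l, r ∈ maximalIdeal R := fun r hr ↦ hl r (by simp [hr])
    have := nontrivial_quotSMulTop_of_mem_maximalIdeal M hxm
    let e := Submodule.quotOfListConsSMulTopEquivQuotSMulTopInner M x l
    rw [Module.supportDim_eq_of_equiv e, List.length_cons, Nat.cast_succ, ← add_assoc] at hdrop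
    rw [LinearEquiv.AssociatedPrimes.eq e] at hP
    have hle : Module.supportDim R (QuotSMulTop x M) + 1 ≤ n :=
      le_trans (by gcongr; exact supportDim_le_supportDim_quotient_add_length l hlm) hdrop
    have hx : IsSMulRegular M x := by
      rw [isSMulRegular_iff_right_eq_zero_of_smul]
      intro m hm
      by_contra hm0
      have hmem : x ∈ ⋃ p ∈ associatedPrimes R M, (p : Set R) := by
        rw [biUnion_associatedPrimes_eq_zero_divisors]
        exact ⟨m, hm0, hm⟩
      obtain ⟨Q, hQ, hxQ⟩ := Set.mem_iUnion₂.mp hmem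
      have hQp := hQ.isPrime
      have hsupp : (⟨Q, hQp⟩ : PrimeSpectrum R) ∈ Module.support R (QuotSMulTop x M) := by
        rw [Module.support_quotSMulTop]
        refine ⟨Module.mem_support_iff_of_finite.mpr
          (annihilator_le_of_mem_associatedPrimes hQ), ?_⟩
        simpa using hxQ
      have h1 := ringKrullDim_quotient_le_supportDim_s14 (Module.mem_support_iff_of_finite.mp hsupp)
      rw [ringKrullDim_quotient_eq_of_mem_associatedPrimes hdim hreg hQ] at h1
      have h2 : ((n + 1 : ℕ) : WithBot ℕ∞) ≤ (n : ℕ) := by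
        rw [Nat.cast_succ]
        exact le_trans (by gcongr) hle
      have h3 : n + 1 ≤ n := by exact_mod_cast h2
      omega
    have hsucc := Module.supportDim_quotSMulTop_succ_eq_supportDim hx hxm
    have hn : n ≠ 0 := by
      rintro rfl
      exact Module.supportDim_ne_bot_of_nontrivial R (QuotSMulTop x M)
        ((ENat.WithBot.add_one_le_zero_iff _).mp hle)
    obtain ⟨k, rfl⟩ := Nat.exists_eq_succ_of_ne_zero hn
    have cancel {a b : WithBot ℕ∞} : a + 1 ≤ b + 1 → a ≤ b := ENat.WithBot.add_le_add_one_right_iff.mp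
    have hk : Module.supportDim R (QuotSMulTop x M) = k := by
      rw [hdim, Nat.succ_eq_add_one, Nat.cast_succ] at hsucc
      exact le_antisymm (cancel hsucc.le) (cancel hsucc.ge)
    have := ih hlm hk (exists_isRegular_quotSMulTop hx hxm hreg)
      (cancel (by exact_mod_cast hdrop)) hP
    rw [List.length_cons, Nat.cast_succ, ← add_assoc, this, Nat.succ_eq_add_one, Nat.cast_succ]

lemma exists_isRegular_length_eq_of_isCMModule [Nontrivial M] {d : ℕ}
    (hd : moduleDim R M = (d : ℕ)) (hM : IsCMModule R M) :
    ∃ rs : List R, rs.length = d ∧ (∀ r ∈ rs, r ∈ maximalIdeal R) ∧ IsRegular M rs := by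
  have hle : ∀ rs : List R, (∀ r ∈ rs, r ∈ maximalIdeal R) → IsRegular M rs → rs.length ≤ d := by
    intro rs hm hrs
    obtain ⟨P, hP⟩ := associatedPrimes.nonempty R M
    have h := (length_le_ringKrullDim_quotient_of_isRegular rs hm hrs hP).trans
      (ringKrullDim_quotient_le_supportDim_s14 (annihilator_le_of_mem_associatedPrimes hP))
    rw [Module.supportDim_eq_ringKrullDim_quotient_annihilator] at h
    exact Nat.cast_le.mp (h.trans hd.le)
  by_contra! hc
  have hd0 : d ≠ 0 := fun h ↦ hc [] h.symm (by simp) (IsRegular.nil R M)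
  have hsup : moduleDepth R M ≤ ((d - 1 : ℕ) : WithBot ℕ∞) := by
    refine sSup_le ?_
    rintro _ ⟨rs, rfl, hm, hrs⟩
    have h1 := hle rs hm hrs
    have h2 : rs.length ≠ d := fun h ↦ hc rs h hm hrs
    exact Nat.cast_le.mpr (by omega)
  rw [hM, hd] at hsup
  have : d ≤ d - 1 := Nat.cast_le.mp hsup
  omega

end

theorem stmt14 (R M : Type*) [CommRing R] [IsLocalRing R] [IsNoetherianRing R]
    [AddCommGroup M] [Module R M] [Module.Finite R M] [Nontrivial M]
    {d r : ℕ} (hd : moduleDim R M = (d : ℕ)) (hM : IsCMModule R M)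
    (x : Fin r → R) (hx : IsPartSoP R M x) :
    ∀ P ∈ associatedPrimes R (M ⧸ (Ideal.span (Set.range x) • (⊤ : Submodule R M))),
      ringKrullDim (R ⧸ P) = ((d - r : ℕ) : WithBot (WithTop ℕ)) := by
  intro P hP
  obtain ⟨d', hrd, y, ⟨hym, hyd, hfl⟩, hyx⟩ := hx
  obtain rfl : d' = d := Nat.cast_injective (R := WithBot ℕ∞) (hyd.symm.trans hd)
  have hxm : ∀ r ∈ List.ofFn x, r ∈ maximalIdeal R := by
    simp only [List.mem_ofFn', Set.mem_range, forall_exists_index, forall_apply_eq_imp_iff]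
    exact fun i ↦ hyx i ▸ hym _
  let z : Fin (d' - r) → R := fun i ↦ y ⟨r + i, by omega⟩
  have hzm : ∀ r ∈ List.ofFn z, r ∈ maximalIdeal R := by
    simp only [List.mem_ofFn', Set.mem_range, forall_exists_index, forall_apply_eq_imp_iff]
    exact fun i ↦ hym _
  have ofList_ofFn {n : ℕ} (f : Fin n → R) : Ideal.ofList (List.ofFn f) =
      Ideal.span (Set.range f) := by
    simp [Ideal.ofList, List.mem_ofFn', Set.range]
  have hyz : Set.range y = Set.range x ∪ Set.range z := by
    apply subset_antisymm
    · rintro _ ⟨i, rfl⟩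
      by_cases hi : (i : ℕ) < r
      · exact .inl ⟨⟨i, hi⟩, (hyx _).symm⟩
      · refine .inr ⟨⟨i - r, by omega⟩, congrArg y (Fin.ext ?_)⟩
        simp only
        omega
    · rintro _ (⟨i, rfl⟩ | ⟨i, rfl⟩)
      · exact ⟨_, hyx i⟩
      · exact ⟨_, rfl⟩
  rw [← ofList_ofFn] at hP
  have hsupp : Module.supportDim R ((M ⧸ Ideal.ofList (List.ofFn x) • (⊤ : Submodule R M)) ⧸
      Ideal.ofList (List.ofFn z) •
        (⊤ : Submodule R (M ⧸ Ideal.ofList (List.ofFn x) • (⊤ : Submodule R M)))) =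
      Module.supportDim R (M ⧸ Ideal.span (Set.range y) • (⊤ : Submodule R M)) := by
    rw [Module.supportDim, Module.supportDim, Module.support_quotient, Module.support_quotient,
      Module.support_quotient, ofList_ofFn, ofList_ofFn, Set.inter_assoc, hyz, Ideal.span_union,
      PrimeSpectrum.zeroLocus_sup]
  have hdrop := supportDim_le_supportDim_quotient_add_length
    (M := M ⧸ Ideal.ofList (List.ofFn x) • (⊤ : Submodule R M)) _ hzm
  rw [hsupp, List.length_ofFn] at hdrop
  have hdrop' : Module.supportDim R (M ⧸ Ideal.ofList (List.ofFn x) • (⊤ : Submodule R M)) ≤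
      ((d' - r : ℕ) : WithBot ℕ∞) := by
    refine hdrop.trans ?_
    grw [supportDim_nonpos_of_isFiniteLength hfl, zero_add]
  have hsum : ((d' - r : ℕ) : WithBot ℕ∞) + (r : ℕ) = (d' : ℕ) := by
    rw [← Nat.cast_add, Nat.sub_add_cancel hrd]
  have key := ringKrullDim_quotient_add_length_of_mem_associatedPrimes (List.ofFn x) hxm
    ((Module.supportDim_eq_ringKrullDim_quotient_annihilator R M).trans hd)
    (exists_isRegular_length_eq_of_isCMModule hd hM)
    (by rw [List.length_ofFn, ← hsum]; gcongr) hP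
  rw [List.length_ofFn, ← hsum] at key
  exact ENat.WithBot.add_natCast_cancel.mp key
end
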